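/- arXiv:2408.17331 — 2 statements merged into one kernel-verified Lean document; each statement's English description precedes it below -/
import Mathlib

section
/- For every integer k ≥ 0 and every r with 2πk/(2k+1) ≤ r < 2π(k+1)/(2k+3), the Vietoris–Rips metric thickening VR^m(S^1;r) is homotopy equivalent to the (2k+1)-dimensional sphere S^{2k+1}. -/
open MeasureTheory Metric Set
open scoped NNReal ENNReal

noncomputable section

/-- The circle `S¹ = ℝ/2πℤ`, with the quotient (geodesic) metric. -/
abbrev Circ : Type := AddCircle (2 * Real.pi)

instance : Fact (0 < 2 * Real.pi) := ⟨by positivity⟩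

/-- The support of a finitely-supported measure: the set of atoms. -/
def mSupport {X : Type*} [MeasurableSpace X] (μ : ProbabilityMeasure X) : Set X :=
  {x | μ.toMeasure {x} ≠ 0}

/-- A probability measure is finitely supported if some finite set has full measure. -/
def FinSupp {X : Type*} [MeasurableSpace X] (μ : ProbabilityMeasure X) : Prop :=
  ∃ S : Finset X, μ.toMeasure ↑S = 1

/-- The Vietoris--Rips metric thickening `VR^m(X; r)`: the set of finitely supported
probability measures on `X` whose support has diameter at most `r`, topologized as a subspace
of the probability measures on `X` with the topology of weak convergence. -/
def VRm (X : Type*) [MetricSpace X] [MeasurableSpace X] (r : ℝ) :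
    Set (ProbabilityMeasure X) :=
  {μ | FinSupp μ ∧ Metric.diam (mSupport μ) ≤ r}

/-- Binary forms of degree `n` in `(cos, sin)`. -/
def frm (n : ℕ) (a : EuclideanSpace ℝ (Fin (n + 1))) (x : ℝ) : ℝ :=
  ∑ i : Fin (n + 1), a i * (Real.cos x ^ i.1 * Real.sin x ^ i.rev.1)

/-- Formal derivative of a form. -/
def dfrm (n : ℕ) (a : EuclideanSpace ℝ (Fin (n + 1))) (x : ℝ) : ℝ :=
  ∑ i : Fin (n + 1), a i * ((i.1 * Real.cos x ^ (i.1 - 1) * (-Real.sin x)) * Real.sin x ^ i.rev.1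
    + Real.cos x ^ i.1 * (i.rev.1 * Real.sin x ^ (i.rev.1 - 1) * Real.cos x))

lemma frm_hasDerivAt (n : ℕ) (a : EuclideanSpace ℝ (Fin (n + 1))) (x : ℝ) :
    HasDerivAt (frm n a) (dfrm n a x) x := by
  unfold frm dfrm
  refine HasDerivAt.fun_sum fun i _ => ?_
  refine HasDerivAt.const_mul _ ?_
  exact ((Real.hasDerivAt_cos x).pow i.1).mul ((Real.hasDerivAt_sin x).pow i.rev.1)

lemma frm_cont (n : ℕ) : Continuous (fun q : EuclideanSpace ℝ (Fin (n + 1)) × ℝ => frm n q.1 q.2) := by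
  unfold frm; fun_prop

lemma dfrm_cont (n : ℕ) : Continuous (fun q : EuclideanSpace ℝ (Fin (n + 1)) × ℝ => dfrm n q.1 q.2) := by
  unfold dfrm; fun_prop

lemma frm_cont' (n : ℕ) (a) : Continuous (frm n a) := by
  unfold frm; fun_prop

lemma dfrm_cont' (n : ℕ) (a) : Continuous (dfrm n a) := by
  unfold dfrm; fun_prop

lemma frm_anti {n : ℕ} (hn : Odd n) (a) (x : ℝ) : frm n a (x + Real.pi) = - frm n a x := by
  unfold frm
  rw [← Finset.sum_neg_distrib]
  refine Finset.sum_congr rfl fun i _ => ?_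
  rw [Real.cos_add_pi, Real.sin_add_pi, neg_pow, neg_pow (Real.sin x)]
  have h : (-1 : ℝ) ^ i.1 * (-1) ^ i.rev.1 = -1 := by
    rw [← pow_add]
    have : i.1 + i.rev.1 = n := by rw [Fin.val_rev]; omega
    rw [this]; exact hn.neg_one_pow
  linear_combination (a i * Real.cos x ^ i.1 * Real.sin x ^ i.rev.1) * h

lemma frm_add (n : ℕ) (a b) (x : ℝ) : frm n (a + b) x = frm n a x + frm n b x := by
  unfold frm
  rw [← Finset.sum_add_distrib]
  exact Finset.sum_congr rfl fun i _ => by simp; ring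

lemma frm_smul (n : ℕ) (c : ℝ) (a) (x : ℝ) : frm n (c • a) x = c * frm n a x := by
  unfold frm
  rw [Finset.mul_sum]
  exact Finset.sum_congr rfl fun i _ => by simp; ring

/-- The submodule of forms. -/
def Hf (n : ℕ) : Submodule ℝ (ℝ → ℝ) where
  carrier := {f | ∃ a, f = frm n a}
  add_mem' := by
    rintro _ _ ⟨a, rfl⟩ ⟨b, rfl⟩
    exact ⟨a + b, by ext x; simp [frm_add]⟩
  zero_mem' := ⟨0, by ext x; simp [frm]⟩
  smul_mem' := by
    rintro c _ ⟨a, rfl⟩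
    exact ⟨c • a, by ext x; simp [frm_smul]⟩

lemma mono_mem (n i j : ℕ) (h : i + j = n) :
    (fun x => Real.cos x ^ i * Real.sin x ^ j) ∈ Hf n := by
  refine ⟨EuclideanSpace.single (⟨i, by omega⟩ : Fin (n + 1)) 1, ?_⟩
  ext x
  unfold frm
  rw [Finset.sum_eq_single (⟨i, by omega⟩ : Fin (n + 1))]
  · have : n - i = j := by omega
    simp [this]
  · intro b _ hb
    simp [hb]
  · simp

lemma dfrm_mem (n : ℕ) (a) : dfrm n a ∈ Hf n := by
  have : dfrm n a = ∑ i : Fin (n + 1), a i • (fun x : ℝ => (i.1 * Real.cos x ^ (i.1 - 1) * (-Real.sin x)) * Real.sin x ^ i.rev.1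
    + Real.cos x ^ i.1 * (i.rev.1 * Real.sin x ^ (i.rev.1 - 1) * Real.cos x)) := by
    ext x
    simp [dfrm, Finset.sum_apply]
  rw [this]
  refine Submodule.sum_mem _ fun i _ => Submodule.smul_mem _ _ ?_
  have hi : i.1 + i.rev.1 = n := by rw [Fin.val_rev]; omega
  generalize i.1 = u at *
  generalize i.rev.1 = v at *
  have h1 : (fun x : ℝ => (u * Real.cos x ^ (u - 1) * (-Real.sin x)) * Real.sin x ^ v) ∈ Hf n := by
    rcases u with _ | u
    · convert Submodule.zero_mem (Hf n) using 1
      ext x; simp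
    · convert Submodule.smul_mem _ (-((u + 1 : ℕ) : ℝ)) (mono_mem n u (v + 1) (by omega)) using 1
      ext x; simp; ring
  have h2 : (fun x : ℝ => Real.cos x ^ u * (v * Real.sin x ^ (v - 1) * Real.cos x)) ∈ Hf n := by
    rcases v with _ | v
    · convert Submodule.zero_mem (Hf n) using 1
      ext x; simp
    · convert Submodule.smul_mem _ (((v + 1 : ℕ) : ℝ)) (mono_mem n (u + 1) v (by omega)) using 1
      ext x; simp; ring
  exact Submodule.add_mem _ h1 h2

lemma dfrm_eq (n : ℕ) (a) : ∃ b, dfrm n a = frm n b := dfrm_mem n a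

lemma mul_cos_mem (n : ℕ) (f) (hf : f ∈ Hf n) (α β : ℝ) :
    (fun x => (α * Real.cos x + β * Real.sin x) * f x) ∈ Hf (n + 1) := by
  obtain ⟨a, rfl⟩ := hf
  have : (fun x => (α * Real.cos x + β * Real.sin x) * frm n a x)
      = ∑ i : Fin (n + 1), ((a i * α) • (fun x : ℝ => Real.cos x ^ (i.1 + 1) * Real.sin x ^ i.rev.1)
        + (a i * β) • (fun x : ℝ => Real.cos x ^ i.1 * Real.sin x ^ (i.rev.1 + 1))) := by
    ext x
    simp only [frm, Finset.mul_sum, Finset.sum_apply, Pi.add_apply, Pi.smul_apply, smul_eq_mul]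
    refine Finset.sum_congr rfl fun i _ => ?_
    ring
  rw [this]
  refine Submodule.sum_mem _ fun i _ => ?_
  have hi : i.1 + i.rev.1 = n := by rw [Fin.val_rev]; omega
  exact Submodule.add_mem _ (Submodule.smul_mem _ _ (mono_mem _ _ _ (by omega)))
    (Submodule.smul_mem _ _ (mono_mem _ _ _ (by omega)))

lemma prod_sin_mem (n : ℕ) (z : ℕ → ℝ) :
    (fun x => ∏ j ∈ Finset.range n, Real.sin (z j - x)) ∈ Hf n := by
  induction n with
  | zero =>
    convert mono_mem 0 0 0 rfl using 1
    ext x; simp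
  | succ n ih =>
    convert mul_cos_mem n _ ih (Real.sin (z n)) (-Real.cos (z n)) using 1
    ext x
    rw [Finset.prod_range_succ, Real.sin_sub]; ring

/-- A form vanishing at `n+1` points which are distinct mod `π` vanishes. -/
lemma frm_eq_zero (n : ℕ) (a) (θ : Fin (n + 1) → ℝ)
    (hθ : ∀ i j, i < j → Real.sin (θ j - θ i) ≠ 0) (h : ∀ i, frm n a (θ i) = 0) : a = 0 := by
  have hdet : (Matrix.projVandermonde (fun i => Real.cos (θ i)) (fun i => Real.sin (θ i))).det ≠ 0 := by
    rw [Matrix.det_projVandermonde]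
    refine Finset.prod_ne_zero_iff.2 fun i _ => Finset.prod_ne_zero_iff.2 fun j hj => ?_
    have := hθ i j (Finset.mem_Ioi.1 hj)
    rw [Real.sin_sub] at this
    intro h0
    apply this
    linear_combination -h0
  have := Matrix.eq_zero_of_mulVec_eq_zero hdet (v := fun i => a i) (by
    ext i
    have := h i
    simp only [Matrix.mulVec, dotProduct, Matrix.projVandermonde_apply, Pi.zero_apply]
    rw [← this, frm]
    exact Finset.sum_congr rfl fun j _ => by ring)
  ext i
  exact congrFun this i

/-- Finset version: a nonzero form has at most `n` zeros in `[u, u+π)`. -/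
lemma frm_card_zeros (n : ℕ) (a) (ha : a ≠ 0) (u : ℝ) (Z : Finset ℝ)
    (hZ : ∀ x ∈ Z, x ∈ Ico u (u + Real.pi) ∧ frm n a x = 0) : Z.card ≤ n := by
  by_contra hc
  obtain ⟨Y, hYZ, hY⟩ := Finset.exists_subset_card_eq (show n + 1 ≤ Z.card by omega)
  apply ha
  refine frm_eq_zero n a (Y.orderEmbOfFin hY) ?_ ?_
  · intro i j hij
    have hi := (hZ _ (hYZ (Y.orderEmbOfFin_mem hY i))).1
    have hj := (hZ _ (hYZ (Y.orderEmbOfFin_mem hY j))).1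
    have hl := (Y.orderEmbOfFin hY).lt_iff_lt.2 hij
    exact (Real.sin_pos_of_pos_of_lt_pi (by linarith) (by linarith [hi.1, hj.2])).ne'
  · intro i
    exact (hZ _ (hYZ (Y.orderEmbOfFin_mem hY i))).2

/-- Antiderivative of the tent function. -/
def Wt (ε u : ℝ) : ℝ := ∫ t in (0:ℝ)..u, max 0 (ε - |t|)

lemma tent_cont (ε : ℝ) : Continuous (fun t : ℝ => max 0 (ε - |t|)) := by fun_prop

lemma Wt_hasDerivAt (ε u : ℝ) : HasDerivAt (Wt ε) (max 0 (ε - |u|)) u :=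
  (tent_cont ε).integral_hasStrictDerivAt 0 u |>.hasDerivAt

lemma Wt_neg (ε u : ℝ) : Wt ε (-u) = - Wt ε u := by
  unfold Wt
  have := intervalIntegral.integral_comp_neg (a := 0) (b := u) (fun t : ℝ => max 0 (ε - |t|))
  simp only [abs_neg, neg_zero] at this
  rw [this, intervalIntegral.integral_symm]

lemma Wt_mono (ε : ℝ) : Monotone (Wt ε) :=
  monotone_of_hasDerivAt_nonneg (Wt_hasDerivAt ε) (fun _ => le_max_left _ _)

lemma Wt_self {ε : ℝ} (hε : 0 < ε) : Wt ε ε = ε ^ 2 / 2 := by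
  unfold Wt
  have : ∫ t in (0:ℝ)..ε, max 0 (ε - |t|) = ∫ t in (0:ℝ)..ε, (ε - t) := by
    refine intervalIntegral.integral_congr fun t ht => ?_
    rw [uIcc_of_le hε.le] at ht
    rw [abs_of_nonneg ht.1, max_eq_right (by linarith [ht.2])]
  rw [this, intervalIntegral.integral_sub (by simp) (by simp)]
  simp; ring

lemma Wt_ge {ε u : ℝ} (hε : 0 < ε) (hu : ε ≤ u) : Wt ε u = ε ^ 2 / 2 := by
  rw [← Wt_self hε]
  unfold Wt
  rw [← intervalIntegral.integral_add_adjacent_intervals (b := ε)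
    ((tent_cont ε).intervalIntegrable _ _) ((tent_cont ε).intervalIntegrable _ _)]
  have : ∫ t in ε..u, max 0 (ε - |t|) = ∫ t in ε..u, (0:ℝ) := by
    refine intervalIntegral.integral_congr fun t ht => ?_
    rw [uIcc_of_le hu] at ht
    rw [max_eq_left]
    have := le_abs_self t
    linarith [ht.1]
  rw [this]; simp

lemma Wt_le {ε u : ℝ} (hε : 0 < ε) (hu : u ≤ -ε) : Wt ε u = -(ε ^ 2 / 2) := by
  rw [← neg_neg u, Wt_neg, Wt_ge hε (by linarith)]

lemma Wt_bound {ε : ℝ} (hε : 0 < ε) (u : ℝ) : |Wt ε u| ≤ ε ^ 2 / 2 := by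
  rw [abs_le]
  constructor
  · rcases le_total u (-ε) with h | h
    · rw [Wt_le hε h]
    · rw [← Wt_le hε le_rfl]; exact Wt_mono ε h
  · rcases le_total ε u with h | h
    · rw [Wt_ge hε h]
    · rw [← Wt_ge hε le_rfl]; exact Wt_mono ε h

def dens (n : ℕ) (a : EuclideanSpace ℝ (Fin (n + 1))) (ε x : ℝ) : ℝ :=
  |dfrm n a x| * max 0 (ε - |frm n a x|)

lemma dens_nonneg (n a ε x) : 0 ≤ dens n a ε x :=
  mul_nonneg (abs_nonneg _) (le_max_left _ _)

lemma dens_cont (n : ℕ) : Continuous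
    (fun q : (EuclideanSpace ℝ (Fin (n + 1)) × ℝ) × ℝ => dens n q.1.1 q.1.2 q.2) := by
  have h1 : Continuous (fun q : (EuclideanSpace ℝ (Fin (n + 1)) × ℝ) × ℝ => dfrm n q.1.1 q.2) :=
    (dfrm_cont n).comp (by fun_prop : Continuous fun q : (EuclideanSpace ℝ (Fin (n + 1)) × ℝ) × ℝ => (q.1.1, q.2))
  have h2 : Continuous (fun q : (EuclideanSpace ℝ (Fin (n + 1)) × ℝ) × ℝ => frm n q.1.1 q.2) :=
    (frm_cont n).comp (by fun_prop : Continuous fun q : (EuclideanSpace ℝ (Fin (n + 1)) × ℝ) × ℝ => (q.1.1, q.2))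
  unfold dens
  fun_prop

lemma dens_cont' (n a ε) : Continuous (dens n a ε) := by
  have h1 := frm_cont' n a
  have h2 := dfrm_cont' n a
  unfold dens
  fun_prop

lemma dens_int (n a ε x y) : IntervalIntegrable (dens n a ε) volume x y :=
  (dens_cont' n a ε).intervalIntegrable _ _

lemma dfrm_anti {n : ℕ} (hn : Odd n) (a) (x : ℝ) : dfrm n a (x + Real.pi) = - dfrm n a x := by
  obtain ⟨b, hb⟩ := dfrm_eq n a
  rw [hb, frm_anti hn]

lemma dens_per {n : ℕ} (hn : Odd n) (a ε) : Function.Periodic (dens n a ε) Real.pi := by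
  intro x
  unfold dens
  rw [frm_anti hn, dfrm_anti hn, abs_neg, abs_neg]

lemma ftc_W (n a) (ε x y : ℝ) :
    ∫ t in x..y, max 0 (ε - |frm n a t|) * dfrm n a t = Wt ε (frm n a y) - Wt ε (frm n a x) := by
  have h1 := frm_cont' n a
  have h2 := dfrm_cont' n a
  refine intervalIntegral.integral_eq_sub_of_hasDerivAt (f := fun t => Wt ε (frm n a t)) ?_ ?_
  · intro t _
    exact (Wt_hasDerivAt ε (frm n a t)).comp t (frm_hasDerivAt n a t)
  · exact Continuous.intervalIntegrable (by fun_prop) _ _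

lemma dens_cross (n a) {ε x y : ℝ} (hxy : x ≤ y) :
    |Wt ε (frm n a y) - Wt ε (frm n a x)| ≤ ∫ t in x..y, dens n a ε t := by
  rw [← ftc_W]
  refine (intervalIntegral.abs_integral_le_integral_abs hxy).trans (le_of_eq ?_)
  refine intervalIntegral.integral_congr fun t _ => ?_
  simp only [dens]
  rw [abs_mul, abs_of_nonneg (le_max_left (0:ℝ) _), mul_comm]

lemma dens_piece (n a) {ε x y : ℝ} (hε : 0 < ε) (hxy : x ≤ y)
    (h0 : ∀ t ∈ Ioo x y, dfrm n a t ≠ 0) : ∫ t in x..y, dens n a ε t ≤ ε ^ 2 := by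
  have hW : ∀ u v, |Wt ε u - Wt ε v| ≤ ε ^ 2 := fun u v => by
    have h1 := abs_le.1 (Wt_bound hε u)
    have h2 := abs_le.1 (Wt_bound hε v)
    rw [abs_le]; constructor <;> linarith
  have h2 := dfrm_cont' n a
  have key : (∀ t ∈ Ioo x y, 0 ≤ dfrm n a t) ∨ (∀ t ∈ Ioo x y, dfrm n a t ≤ 0) := by
    by_contra hcon
    push Not at hcon
    obtain ⟨⟨u, hu, hu'⟩, ⟨v, hv, hv'⟩⟩ := hcon
    have := isPreconnected_Ioo.intermediate_value hu hv h2.continuousOn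
    obtain ⟨w, hw, hw'⟩ := this ⟨hu'.le, hv'.le⟩
    exact h0 w hw hw'
  have hae : ∀ (f g : ℝ → ℝ), (∀ t ∈ Ioo x y, f t = g t) → ∫ t in x..y, f t = ∫ t in x..y, g t := by
    intro f g hfg
    rw [intervalIntegral.integral_of_le hxy, intervalIntegral.integral_of_le hxy,
      integral_Ioc_eq_integral_Ioo, integral_Ioc_eq_integral_Ioo]
    exact setIntegral_congr_fun measurableSet_Ioo hfg
  rcases key with h | h
  · rw [hae (dens n a ε) (fun t => max 0 (ε - |frm n a t|) * dfrm n a t)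
      (fun t ht => by simp only [dens]; rw [abs_of_nonneg (h t ht), mul_comm]), ftc_W]
    exact (le_abs_self _).trans (hW _ _)
  · rw [hae (dens n a ε) (fun t => -(max 0 (ε - |frm n a t|) * dfrm n a t))
      (fun t ht => by simp only [dens]; rw [abs_of_nonpos (h t ht)]; ring),
      intervalIntegral.integral_neg, ftc_W]
    exact (neg_le_abs _).trans (hW _ _)

lemma dens_count (n a) {ε : ℝ} (hε : 0 < ε) (m : ℕ) : ∀ x y : ℝ, x ≤ y → ∀ Z : Finset ℝ,
    (∀ t ∈ Ioo x y, dfrm n a t = 0 → t ∈ Z) → Z.card ≤ m →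
    ∫ t in x..y, dens n a ε t ≤ (m + 1) * ε ^ 2 := by
  induction m with
  | zero =>
    intro x y hxy Z hZ hc
    have : Z = ∅ := by simpa using hc
    subst this
    simpa using dens_piece n a hε hxy (fun t ht h => by simpa using hZ t ht h)
  | succ m ih =>
    intro x y hxy Z hZ hc
    by_cases h0 : ∀ t ∈ Ioo x y, dfrm n a t ≠ 0
    · refine (dens_piece n a hε hxy h0).trans ?_
      push_cast
      nlinarith [sq_nonneg ε, (Nat.cast_nonneg m : (0:ℝ) ≤ m)]
    -- take the largest zero of the derivative
    · push Not at h0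
      obtain ⟨t0, ht0, ht0'⟩ := h0
      let Y := Z.filter (fun t => t ∈ Ioo x y ∧ dfrm n a t = 0)
      have hY : Y.Nonempty := ⟨t0, by simp only [Y, Finset.mem_filter]; exact ⟨hZ t0 ht0 ht0', ht0, ht0'⟩⟩
      obtain ⟨c, hcY, hmax⟩ := Y.exists_max_image id hY
      simp only [Y, Finset.mem_filter, id] at hcY hmax
      obtain ⟨hcZ, hcI, hcz⟩ := hcY
      rw [← intervalIntegral.integral_add_adjacent_intervals (dens_int n a ε x c) (dens_int n a ε c y)]
      have e1 := ih x c hcI.1.le (Z.erase c) (fun t ht h => Finset.mem_erase.2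
        ⟨ht.2.ne, hZ t ⟨ht.1, ht.2.trans hcI.2⟩ h⟩) (by rw [Finset.card_erase_of_mem hcZ]; omega)
      have e2 := dens_piece n a hε hcI.2.le (fun t ht h => by
        have := hmax t ⟨hZ t ⟨hcI.1.trans ht.1, ht.2⟩ h, ⟨hcI.1.trans ht.1, ht.2⟩, h⟩
        linarith [ht.1])
      push_cast
      linarith

lemma frm_ne_zero_of (n : ℕ) (a) (h : ∀ x, frm n a x = 0) : a = 0 := by
  by_contra ha
  have := frm_card_zeros n a ha 0 ((Finset.range (n + 1)).image (fun j : ℕ => Real.pi * j / (n + 1)))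
    (by
      intro x hx
      obtain ⟨j, hj, rfl⟩ := Finset.mem_image.1 hx
      refine ⟨⟨by positivity, ?_⟩, h _⟩
      rw [zero_add, div_lt_iff₀ (by positivity)]
      have : (j : ℝ) < n + 1 := by exact_mod_cast Finset.mem_range.1 hj
      nlinarith [Real.pi_pos])
  rw [Finset.card_image_of_injective] at this
  · simp at this
  · intro i j hij
    simp only [] at hij
    have hp := Real.pi_pos
    field_simp at hij
    exact_mod_cast hij

lemma dens_total {n : ℕ} (hn : Odd n) (a) (ha : a ≠ 0) {ε : ℝ} (hε : 0 < ε) :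
    ∫ t in (0:ℝ)..Real.pi, dens n a ε t ≤ n * ε ^ 2 := by
  obtain ⟨b, hb⟩ := dfrm_eq n a
  have hb0 : b ≠ 0 := by
    rintro rfl
    apply ha
    have hd : ∀ x, dfrm n a x = 0 := fun x => by rw [hb]; simp [frm]
    have hconst : ∀ x y, frm n a x = frm n a y :=
      is_const_of_deriv_eq_zero (fun x => (frm_hasDerivAt n a x).differentiableAt)
        (fun x => by rw [(frm_hasDerivAt n a x).deriv, hd])
    refine frm_ne_zero_of n a fun x => ?_
    have h1 := hconst (x + Real.pi) x
    rw [frm_anti hn] at h1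
    linarith
  -- a zero of the derivative
  obtain ⟨ζ, hζ⟩ : ∃ ζ, dfrm n a ζ = 0 := by
    have hc := (dfrm_cont' n a)
    have h1 := dfrm_anti hn a 0
    rcases le_total (dfrm n a 0) 0 with h | h
    · exact mem_range_of_exists_le_of_exists_ge hc ⟨0, h⟩ ⟨0 + Real.pi, by linarith⟩
    · exact mem_range_of_exists_le_of_exists_ge hc ⟨0 + Real.pi, by linarith⟩ ⟨0, h⟩
  have hper := (dens_per hn a ε).intervalIntegral_add_eq 0 ζ
  rw [zero_add] at hper
  rw [hper]
  -- finiteness of zeros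
  have hfin : {t | t ∈ Ico ζ (ζ + Real.pi) ∧ dfrm n a t = 0}.Finite := by
    by_contra hinf
    obtain ⟨Z, hZ, hcard⟩ := Set.Infinite.exists_subset_card_eq hinf (n + 1)
    have := frm_card_zeros n b hb0 ζ Z (fun x hx => by
      have := hZ hx
      rw [← hb]; exact this)
    omega
  have hcard := frm_card_zeros n b hb0 ζ hfin.toFinset (fun x hx => by
      rw [← hb]; simpa using hx)
  have hmem : ζ ∈ hfin.toFinset := by
    simp [hζ, Real.pi_pos]
  have hpos : 0 < n := hn.pos
  have := dens_count n a hε (n - 1) ζ (ζ + Real.pi) (by linarith [Real.pi_pos]) (hfin.toFinset.erase ζ)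
    (fun t ht h => by
      simp only [Finset.mem_erase, Set.Finite.mem_toFinset, Set.mem_ofPred_eq]
      exact ⟨ht.1.ne', ⟨ht.1.le, ht.2⟩, h⟩) (by rw [Finset.card_erase_of_mem hmem]; omega)
  refine this.trans (le_of_eq ?_)
  rw [Nat.cast_sub (by omega)]; push_cast; ring

def Idn (n : ℕ) (a : EuclideanSpace ℝ (Fin (n + 1))) (ε x : ℝ) : ℝ :=
  ∫ t in (0:ℝ)..x, dens n a ε t

def Tl (n : ℕ) (a : EuclideanSpace ℝ (Fin (n + 1))) (ε t x : ℝ) : ℝ :=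
  x + t * (Real.pi * Idn n a ε x / Idn n a ε Real.pi - x)

lemma Idn_cont (n : ℕ) : Continuous
    (fun q : (EuclideanSpace ℝ (Fin (n + 1)) × ℝ) × ℝ => Idn n q.1.1 q.1.2 q.2) := by
  have h : Continuous (Function.uncurry (fun (q : (EuclideanSpace ℝ (Fin (n + 1)) × ℝ) × ℝ) (t : ℝ) =>
      dens n q.1.1 q.1.2 t)) :=
    (dens_cont n).comp (by fun_prop : Continuous fun z : ((EuclideanSpace ℝ (Fin (n + 1)) × ℝ) × ℝ) × ℝ => (z.1.1, z.2))
  exact intervalIntegral.continuous_parametric_intervalIntegral_of_continuous h continuous_snd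

lemma Idn_sub (n a ε x y) : Idn n a ε y - Idn n a ε x = ∫ t in x..y, dens n a ε t := by
  unfold Idn
  rw [intervalIntegral.integral_interval_sub_left (dens_int _ _ _ _ _) (dens_int _ _ _ _ _)]

lemma Idn_mono (n a ε) : Monotone (Idn n a ε) := by
  intro x y hxy
  have := intervalIntegral.integral_nonneg (μ := volume) hxy (fun t _ => dens_nonneg n a ε t)
  rw [← Idn_sub] at this
  linarith

lemma Idn_add_pi {n : ℕ} (hn : Odd n) (a ε x) :
    Idn n a ε (x + Real.pi) = Idn n a ε x + Idn n a ε Real.pi := by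
  have h1 := Idn_sub n a ε x (x + Real.pi)
  rw [(dens_per hn a ε).intervalIntegral_add_eq x 0, zero_add] at h1
  have : Idn n a ε Real.pi = ∫ t in (0:ℝ)..Real.pi, dens n a ε t := rfl
  linarith

lemma Idn_cross (n a) {ε x y : ℝ} (hε : 0 < ε) (hxy : x < y)
    (h : (ε ≤ frm n a x ∧ frm n a y ≤ -ε) ∨ (ε ≤ frm n a y ∧ frm n a x ≤ -ε)) :
    ε ^ 2 ≤ Idn n a ε y - Idn n a ε x := by
  rw [Idn_sub]
  refine le_trans ?_ (dens_cross n a hxy.le)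
  rcases h with ⟨h1, h2⟩ | ⟨h1, h2⟩
  · rw [Wt_ge hε h1, Wt_le hε h2, abs_sub_comm]
    exact le_trans (by linarith) (le_abs_self _)
  · rw [Wt_ge hε h1, Wt_le hε h2]
    exact le_trans (by linarith) (le_abs_self _)

/-- admissible parameters -/
structure Adm (n : ℕ) (a : EuclideanSpace ℝ (Fin (n + 1))) (ε : ℝ) : Prop where
  odd : Odd n
  pos : 0 < ε
  ne : a ≠ 0
  ex : ∃ x, ε ≤ frm n a x

namespace Adm
variable {n : ℕ} {a : EuclideanSpace ℝ (Fin (n + 1))} {ε : ℝ}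

lemma tot_ge (h : Adm n a ε) : ε ^ 2 ≤ Idn n a ε Real.pi := by
  obtain ⟨x, hx⟩ := h.ex
  have := Idn_cross n a (x := x) (y := x + Real.pi) h.pos (by linarith [Real.pi_pos])
    (Or.inl ⟨hx, by rw [frm_anti h.odd]; linarith⟩)
  rw [Idn_add_pi h.odd] at this
  linarith

lemma tot_pos (h : Adm n a ε) : 0 < Idn n a ε Real.pi :=
  lt_of_lt_of_le (by have := h.pos; positivity) h.tot_ge

lemma tot_le (h : Adm n a ε) : Idn n a ε Real.pi ≤ n * ε ^ 2 :=
  dens_total h.odd a h.ne h.pos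

lemma Tl_add_pi (h : Adm n a ε) (t x) : Tl n a ε t (x + Real.pi) = Tl n a ε t x + Real.pi := by
  unfold Tl
  rw [Idn_add_pi h.odd]
  have := h.tot_pos
  field_simp
  ring

lemma Tl_mono (h : Adm n a ε) {t} (ht : t ∈ Icc (0:ℝ) 1) : Monotone (Tl n a ε t) := by
  intro x y hxy
  have h1 := Idn_mono n a ε hxy
  have h2 : Real.pi * Idn n a ε x / Idn n a ε Real.pi ≤ Real.pi * Idn n a ε y / Idn n a ε Real.pi := by
    have := h.tot_pos
    have := Real.pi_pos
    gcongr
  unfold Tl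
  nlinarith [mul_le_mul_of_nonneg_left h2 ht.1, mul_nonneg (sub_nonneg.2 ht.2) (sub_nonneg.2 hxy)]

/-- displacement of crossings -/
lemma cross (h : Adm n a ε) {x y : ℝ} (hxy : x < y)
    (hc : (ε ≤ frm n a x ∧ frm n a y ≤ -ε) ∨ (ε ≤ frm n a y ∧ frm n a x ≤ -ε)) {t} (ht : t ∈ Icc (0:ℝ) 1) :
    (1 - t) * (y - x) + t * (Real.pi / n) ≤ Tl n a ε t y - Tl n a ε t x := by
  have h1 := Idn_cross n a h.pos hxy hc
  have h2 := h.tot_le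
  have h3 := h.tot_pos
  have hn : (0:ℝ) < n := by exact_mod_cast h.odd.pos
  have hp := Real.pi_pos
  have key : Real.pi / n ≤ Real.pi * (Idn n a ε y - Idn n a ε x) / Idn n a ε Real.pi := by
    rw [div_le_div_iff₀ hn h3]
    have : Idn n a ε Real.pi ≤ (Idn n a ε y - Idn n a ε x) * n := by nlinarith
    nlinarith
  have := mul_le_mul_of_nonneg_left key ht.1
  have e : Tl n a ε t y - Tl n a ε t x = (1 - t) * (y - x) +
      t * (Real.pi * (Idn n a ε y - Idn n a ε x) / Idn n a ε Real.pi) := by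
    unfold Tl; ring
  rw [e]; linarith

lemma cross_lt (h : Adm n a ε) {x y : ℝ}
    (hc : (ε ≤ frm n a x ∧ frm n a y ≤ -ε) ∨ (ε ≤ frm n a y ∧ frm n a x ≤ -ε)) {t} (ht : t ∈ Icc (0:ℝ) 1)
    (hle : Tl n a ε t x ≤ Tl n a ε t y) : x < y := by
  by_contra hxy
  have hne : x ≠ y := by
    rintro rfl
    have := h.pos
    rcases hc with hc | hc <;> linarith [hc.1, hc.2]
  have hlt : y < x := lt_of_le_of_ne (not_lt.1 hxy) hne.symm
  have := h.cross hlt (Or.symm hc) ht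
  have hn : (0:ℝ) < n := by exact_mod_cast h.odd.pos
  have hp : 0 < Real.pi / n := by have := Real.pi_pos; positivity
  rcases ht.1.eq_or_lt with h0 | h0
  · rw [← h0] at this hle; linarith
  · have : 0 < t * (Real.pi / n) := by positivity
    have : 0 ≤ (1 - t) * (x - y) := mul_nonneg (by linarith [ht.2]) (by linarith)
    linarith

lemma cross_abs (h : Adm n a ε) {x y s : ℝ} (hx : ε ≤ frm n a x) (hy : frm n a y ≤ -ε)
    {t} (ht : t ∈ Icc (0:ℝ) 1) (hs : s ≤ Real.pi / n) (hxy : t = 1 ∨ s ≤ |x - y|) :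
    s ≤ |Tl n a ε t x - Tl n a ε t y| := by
  have hne : x ≠ y := by
    rintro rfl
    linarith [h.pos]
  have main : ∀ u v : ℝ, u < v → (t = 1 ∨ s ≤ v - u) →
      ((ε ≤ frm n a u ∧ frm n a v ≤ -ε) ∨ (ε ≤ frm n a v ∧ frm n a u ≤ -ε)) →
      s ≤ Tl n a ε t v - Tl n a ε t u := by
    intro u v huv hs' hc
    refine le_trans ?_ (h.cross huv hc ht)
    rcases hs' with rfl | hs'
    · simpa using hs
    · nlinarith [mul_le_mul_of_nonneg_left hs ht.1, mul_le_mul_of_nonneg_left hs' (sub_nonneg.2 ht.2)]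
  rcases lt_or_gt_of_ne hne with hlt | hlt
  · rw [abs_sub_comm]
    refine (main x y hlt (hxy.imp id fun h => ?_) (Or.inl ⟨hx, hy⟩)).trans (le_abs_self _)
    rwa [abs_sub_comm, abs_of_pos (by linarith)] at h
  · refine (main y x hlt (hxy.imp id fun h => ?_) (Or.inr ⟨hx, hy⟩)).trans (le_abs_self _)
    rwa [abs_of_pos (by linarith)] at h

end Adm

lemma circ_norm_le (x : ℝ) : ‖(x : Circ)‖ ≤ |x| := by
  exact QuotientAddGroup.norm_mk_le_norm (S := AddSubgroup.zmultiples (2 * Real.pi)) (m := x)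

lemma circ_exists_rep (x : ℝ) : ∃ m : ℤ, ‖(x : Circ)‖ = |x - m * (2 * Real.pi)| ∧
    |x - m * (2 * Real.pi)| ≤ Real.pi := by
  refine ⟨round ((2 * Real.pi)⁻¹ * x), AddCircle.norm_eq _, ?_⟩
  rw [← AddCircle.norm_eq]
  have := AddCircle.norm_le_half_period (2 * Real.pi) (x := (x : Circ)) (by positivity)
  rw [abs_of_pos (by positivity)] at this
  linarith

lemma circ_norm_pi : ‖(Real.pi : Circ)‖ = Real.pi := by
  have := AddCircle.norm_half_period_eq (2 * Real.pi)
  rw [abs_of_pos (by positivity)] at this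
  have e : 2 * Real.pi / 2 = Real.pi := by ring
  rw [e] at this
  linarith

lemma circ_add_int (x : ℝ) (m : ℤ) : ((x + m * (2 * Real.pi) : ℝ) : Circ) = x := by
  rw [AddCircle.coe_add]
  have : ((m * (2 * Real.pi) : ℝ) : Circ) = 0 := by
    rw [AddCircle.coe_eq_zero_iff]; exact ⟨m, by simp⟩
  rw [this, add_zero]

lemma circ_eq_iff (x y : ℝ) : (x : Circ) = y ↔ ∃ m : ℤ, x = y + m * (2 * Real.pi) := by
  constructor
  · intro h
    have : ((x - y : ℝ) : Circ) = 0 := by rw [AddCircle.coe_sub, h, sub_self]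
    rw [AddCircle.coe_eq_zero_iff] at this
    obtain ⟨m, hm⟩ := this
    refine ⟨m, ?_⟩
    simp at hm
    linarith
  · rintro ⟨m, rfl⟩
    exact circ_add_int y m

lemma circ_dist_le_iff (u v r : ℝ) : dist (u : Circ) (v : Circ) ≤ r ↔
    ∀ m : ℤ, Real.pi - r ≤ |u - (v + (2 * m + 1) * Real.pi)| := by
  rw [dist_eq_norm, ← AddCircle.coe_sub]
  constructor
  · intro h m
    have h1 := circ_norm_le (u - (v + (2 * m + 1) * Real.pi))
    have h2 : (Real.pi : Circ) = ((u - v : ℝ) : Circ) - ((u - (v + (2 * m + 1) * Real.pi) : ℝ) : Circ) := by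
      rw [← AddCircle.coe_sub, circ_eq_iff]
      exact ⟨-m, by push_cast; ring⟩
    have h3 := norm_sub_le ((u - v : ℝ) : Circ) ((u - (v + (2 * m + 1) * Real.pi) : ℝ) : Circ)
    rw [← h2, circ_norm_pi] at h3
    linarith
  · intro h
    obtain ⟨m, hm, hm'⟩ := circ_exists_rep (u - v)
    rw [hm]
    rcases le_total 0 (u - v - m * (2 * Real.pi)) with h0 | h0
    · have := h m
      rw [abs_of_nonneg h0] at hm' ⊢
      rw [abs_of_nonpos (by linarith)] at this
      linarith
    · have := h (m - 1)
      rw [abs_of_nonpos h0] at hm' ⊢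
      push_cast at this
      rw [abs_of_nonneg (by linarith)] at this
      linarith

lemma frm_per (n a) : Function.Periodic (frm n a) (2 * Real.pi) := by
  intro x
  unfold frm
  rw [Real.cos_add_two_pi, Real.sin_add_two_pi]

/-- forms on the circle -/
def frmC (n : ℕ) (a : EuclideanSpace ℝ (Fin (n + 1))) : Circ → ℝ := (frm_per n a).lift

@[simp] lemma frmC_coe (n a) (x : ℝ) : frmC n a (x : Circ) = frm n a x := rfl

lemma circ_cont_iff {Z Y : Type*} [TopologicalSpace Z] [TopologicalSpace Y] (f : Z × Circ → Y)
    (h : Continuous fun q : Z × ℝ => f (q.1, (q.2 : Circ))) : Continuous f := by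
  have hq : IsOpenQuotientMap (Prod.map id (QuotientAddGroup.mk : ℝ → Circ) : Z × ℝ → Z × Circ) :=
    IsOpenQuotientMap.id.prodMap QuotientAddGroup.isOpenQuotientMap_mk
  rw [← hq.continuous_comp_iff]
  exact h

lemma frmC_cont (n : ℕ) :
    Continuous (fun q : EuclideanSpace ℝ (Fin (n + 1)) × Circ => frmC n q.1 q.2) :=
  circ_cont_iff _ (frm_cont n)

lemma frmC_cont' (n a) : Continuous (frmC n a) :=
  (frmC_cont n).comp (by fun_prop : Continuous fun x : Circ => (a, x))

/-- the circle map induced by `Tl` -/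
def TC (n : ℕ) (a : EuclideanSpace ℝ (Fin (n + 1))) (ε t : ℝ) (c : Circ) : Circ :=
  ((Tl n a ε t (Function.surjInv (QuotientAddGroup.mk_surjective (s := AddSubgroup.zmultiples (2 * Real.pi))) c) : ℝ) : Circ)

lemma Adm.Tl_add_int {n : ℕ} {a : EuclideanSpace ℝ (Fin (n + 1))} {ε : ℝ} (h : Adm n a ε) (t x : ℝ) (m : ℤ) :
    Tl n a ε t (x + m * Real.pi) = Tl n a ε t x + m * Real.pi := by
  induction m using Int.induction_on with
  | zero => simp
  | succ i ih =>
    have := h.Tl_add_pi t (x + i * Real.pi)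
    push_cast at ih ⊢
    rw [ih] at this
    rw [show x + (i + 1) * Real.pi = x + i * Real.pi + Real.pi by ring, this]; ring
  | pred i ih =>
    have := h.Tl_add_pi t (x + (-i - 1) * Real.pi)
    push_cast at ih ⊢
    rw [show x + (-i - 1) * Real.pi + Real.pi = x + -i * Real.pi by ring, ih] at this
    linarith

lemma Adm.TC_coe {n : ℕ} {a : EuclideanSpace ℝ (Fin (n + 1))} {ε : ℝ} (h : Adm n a ε) (t x : ℝ) :
    TC n a ε t (x : Circ) = (Tl n a ε t x : ℝ) := by
  unfold TC
  have h1 := Function.surjInv_eq (QuotientAddGroup.mk_surjective (s := AddSubgroup.zmultiples (2 * Real.pi))) (x : Circ)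
  obtain ⟨m, hm⟩ := (circ_eq_iff _ _).1 h1
  rw [hm, circ_eq_iff]
  refine ⟨m, ?_⟩
  have := h.Tl_add_int t x (2 * m)
  push_cast at this
  rw [show x + m * (2 * Real.pi) = x + 2 * m * Real.pi by ring, this]; ring

lemma TC_zero {n : ℕ} {a : EuclideanSpace ℝ (Fin (n + 1))} {ε : ℝ} (c : Circ) :
    TC n a ε 0 c = c := by
  unfold TC Tl
  rw [zero_mul, add_zero]
  exact Function.surjInv_eq (QuotientAddGroup.mk_surjective (s := AddSubgroup.zmultiples (2 * Real.pi))) c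

lemma TC_cont {Z : Type*} [TopologicalSpace Z] {n : ℕ} {a : Z → EuclideanSpace ℝ (Fin (n + 1))}
    {ε t : Z → ℝ} (ha : Continuous a) (hε : Continuous ε) (ht : Continuous t)
    (h : ∀ z, Adm n (a z) (ε z)) :
    Continuous fun q : Z × Circ => TC n (a q.1) (ε q.1) (t q.1) q.2 := by
  apply circ_cont_iff
  simp only [(h _).TC_coe]
  refine (AddCircle.continuous_mk' _).comp ?_
  unfold Tl
  have h1 : Continuous fun q : Z × ℝ => Idn n (a q.1) (ε q.1) q.2 :=
    (Idn_cont n).comp (by fun_prop : Continuous fun q : Z × ℝ => ((a q.1, ε q.1), q.2))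
  have h2 : Continuous fun q : Z × ℝ => Idn n (a q.1) (ε q.1) Real.pi :=
    (Idn_cont n).comp (by fun_prop : Continuous fun q : Z × ℝ => ((a q.1, ε q.1), Real.pi))
  have h3 : Continuous fun q : Z × ℝ => Real.pi * Idn n (a q.1) (ε q.1) q.2 / Idn n (a q.1) (ε q.1) Real.pi :=
    (continuous_const.mul h1).div h2 (fun q => (h q.1).tot_pos.ne')
  fun_prop

/-- The distance estimate for `TC`. -/
lemma frm_anti_int {n : ℕ} (hn : Odd n) (a) (x : ℝ) (m : ℤ) :
    frm n a (x + (2 * m + 1) * Real.pi) = - frm n a x := by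
  rw [← frm_anti hn]
  have := (frm_per n a).int_mul m (x + Real.pi)
  rw [← this]; congr 1; ring

lemma Adm.TC_dist {n : ℕ} {a : EuclideanSpace ℝ (Fin (n + 1))} {ε : ℝ} (h : Adm n a ε) {t r : ℝ}
    (ht : t ∈ Icc (0:ℝ) 1) (hr : Real.pi - r ≤ Real.pi / n) {x y : Circ}
    (hx : ε ≤ frmC n a x) (hy : ε ≤ frmC n a y) (hd : t = 1 ∨ dist x y ≤ r) :
    dist (TC n a ε t x) (TC n a ε t y) ≤ r := by
  obtain ⟨x, rfl⟩ := QuotientAddGroup.mk_surjective x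
  obtain ⟨y, rfl⟩ := QuotientAddGroup.mk_surjective y
  change ε ≤ frm n a x at hx
  change ε ≤ frm n a y at hy
  change dist (TC n a ε t (x : Circ)) (TC n a ε t (y : Circ)) ≤ r
  rw [h.TC_coe, h.TC_coe, circ_dist_le_iff]
  intro m
  have e := h.Tl_add_int t y (2 * m + 1)
  push_cast at e
  rw [← e]
  refine h.cross_abs hx ?_ ht hr (hd.imp id fun hd => ?_)
  · rw [frm_anti_int h.odd]; linarith
  · exact (circ_dist_le_iff x y r).1 hd m

/-- signed lifts of a subset of the circle -/
def sLift (A : Set Circ) (j : ℕ) : Set ℝ := {x | ((x + j * Real.pi : ℝ) : Circ) ∈ A}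

/-- existence of an alternating sequence of length `j` from `u0` up to `x` -/
def reach (A : Set Circ) (u0 : ℝ) : ℕ → ℝ → Prop
  | 0, x => u0 ≤ x
  | j + 1, x => ∃ y ∈ sLift A (j + 1), y ≤ x ∧ reach A u0 j y

lemma reach_mono {A : Set Circ} {u0 : ℝ} {j : ℕ} {x y : ℝ} (hxy : x ≤ y) (h : reach A u0 j x) :
    reach A u0 j y := by
  cases j with
  | zero => exact le_trans h hxy
  | succ j =>
    obtain ⟨z, hz, hzx, hr⟩ := h
    exact ⟨z, hz, hzx.trans hxy, hr⟩

lemma reach_pred {A : Set Circ} {u0 : ℝ} {j : ℕ} {x : ℝ} (h : reach A u0 (j + 1) x) :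
    reach A u0 j x := by
  obtain ⟨z, hz, hzx, hr⟩ := h
  exact reach_mono hzx hr

lemma reach_of_le {A : Set Circ} {u0 : ℝ} {i j : ℕ} {x : ℝ} (hij : i ≤ j) (h : reach A u0 j x) :
    reach A u0 i x := by
  induction hij with
  | refl => exact h
  | step _ ih => exact ih (reach_pred h)

lemma sLift_two (A : Set Circ) (j : ℕ) : sLift A (j + 2) = sLift A j := by
  ext x
  unfold sLift
  have : (((x + (j + 2 : ℕ) * Real.pi : ℝ)) : Circ) = ((x + j * Real.pi : ℝ) : Circ) := by
    rw [circ_eq_iff]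
    exact ⟨1, by push_cast; ring⟩
  simp only [Set.mem_ofPred_eq, this]

lemma sLift_parity (A : Set Circ) {i j : ℕ} (h : i % 2 = j % 2) : sLift A i = sLift A j := by
  have key : ∀ i, sLift A i = sLift A (i % 2) := by
    intro i
    induction i using Nat.strong_induction_on with
    | _ i ih =>
      rcases i with _ | _ | i
      · rfl
      · rfl
      · rw [sLift_two, ih i (by omega)]
        congr 1; omega
  rw [key i, key j, h]

lemma prod_sign (n c : ℕ) (f : ℕ → ℝ) (hc : c ≤ n) (h1 : ∀ j < c, f j < 0)
    (h2 : ∀ j, c ≤ j → j < n → 0 < f j) : 0 < (-1) ^ c * ∏ j ∈ Finset.range n, f j := by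
  rw [← Finset.prod_range_mul_prod_Ico _ hc, ← mul_assoc]
  refine mul_pos ?_ (Finset.prod_pos fun j hj => ?_)
  · have : (-1 : ℝ) ^ c = ∏ j ∈ Finset.range c, (-1) := by simp
    rw [this, ← Finset.prod_mul_distrib]
    exact Finset.prod_pos fun j hj => by linarith [h1 j (Finset.mem_range.1 hj)]
  · rw [Finset.mem_Ico] at hj
    exact h2 j hj.1 hj.2

/-- separation of finite sets -/
lemma exists_between_finite (X Y : Set ℝ) (hX : X.Finite) (hY : Y.Finite) (hXn : X.Nonempty) (hYn : Y.Nonempty)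
    (h : ∀ x ∈ X, ∀ y ∈ Y, x < y) : ∃ z, (∀ x ∈ X, x < z) ∧ ∀ y ∈ Y, z < y := by
  obtain ⟨x, hx, hx'⟩ := hX.exists_maximalFor id X hXn
  obtain ⟨y, hy, hy'⟩ := hY.exists_minimalFor id Y hYn
  obtain ⟨z, h1, h2⟩ := exists_between (h x hx y hy)
  refine ⟨z, fun x' hx'' => ?_, fun y' hy'' => ?_⟩
  · rcases le_total x' x with h | h
    · linarith
    · exact lt_of_le_of_lt (hx' hx'' h) h1
  · rcases le_total y y' with h | h
    · linarith
    · exact lt_of_lt_of_le h2 (hy' hy'' h)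

lemma circ_rep_Ico (u0 : ℝ) (c : Circ) : ∃ x ∈ Ico u0 (u0 + 2 * Real.pi), (x : Circ) = c := by
  refine ⟨AddCircle.equivIco (2 * Real.pi) u0 c, (AddCircle.equivIco (2 * Real.pi) u0 c).2, ?_⟩
  exact (AddCircle.equivIco (2 * Real.pi) u0).symm_apply_apply c

lemma sLift_finite {A : Set Circ} (hA : A.Finite) (u0 : ℝ) (j : ℕ) :
    (sLift A j ∩ Ico u0 (u0 + Real.pi)).Finite := by
  refine Set.Finite.of_finite_image (f := fun x : ℝ => ((x + j * Real.pi : ℝ) : Circ)) (hA.subset ?_) ?_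
  · rintro _ ⟨x, hx, rfl⟩
    exact hx.1
  · intro x hx y hy hxy
    obtain ⟨m, hm⟩ := (circ_eq_iff _ _).1 hxy
    have hp := Real.pi_pos
    have h1 := hx.2.1; have h2 := hx.2.2; have h3 := hy.2.1; have h4 := hy.2.2
    have hm0 : m = 0 := by
      have a1 : (m : ℝ) < 1 := by nlinarith
      have a2 : (-1 : ℝ) < m := by nlinarith
      have a1' : m < 1 := by exact_mod_cast a1
      have a2' : -1 < m := by exact_mod_cast a2
      omega
    rw [hm0] at hm
    simp at hm
    exact hm

/-- Key separation lemma: few alternations imply existence of a form positive on `A`. -/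
lemma exists_pos_form {n : ℕ} (hn : Odd n) {A : Set Circ} (hA : A.Finite) (u0 : ℝ) (hu0 : (u0 : Circ) ∈ A)
    (hC : ∀ x < u0 + Real.pi, ¬ reach A u0 (n + 1) x) :
    ∃ a, ∀ x ∈ A, 0 < frmC n a x := by
  have hp := Real.pi_pos
  let S : Set ℝ := (sLift A 0 ∩ Ico u0 (u0 + Real.pi)) ∪ (sLift A 1 ∩ Ico u0 (u0 + Real.pi))
  have hS : S.Finite := (sLift_finite hA u0 0).union (sLift_finite hA u0 1)
  have hSI : ∀ x ∈ S, x ∈ Ico u0 (u0 + Real.pi) := by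
    rintro x (hx | hx) <;> exact hx.2
  by_cases hdisj : ∃ x ∈ Ico u0 (u0 + Real.pi), x ∈ sLift A 0 ∧ x ∈ sLift A 1
  · exfalso
    obtain ⟨x, hx, hx0, hx1⟩ := hdisj
    refine hC x hx.2 ?_
    have : ∀ j, reach A u0 j x := by
      intro j
      induction j with
      | zero => exact hx.1
      | succ j ih =>
        refine ⟨x, ?_, le_rfl, ih⟩
        rcases Nat.mod_two_eq_zero_or_one (j + 1) with h | h
        · rwa [sLift_parity A (j := 0) (by omega)]
        · rwa [sLift_parity A (j := 1) (by omega)]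
    exact this _
  have hu0S : u0 ∈ S := Or.inl ⟨by simpa [sLift] using hu0, le_rfl, by linarith⟩
  have hreach1 : ∀ j, ¬ reach A u0 (j + 1) u0 := by
    intro j h
    obtain ⟨z, hz, hz1, hz2⟩ : reach A u0 1 u0 := reach_of_le (by omega) h
    have : z = u0 := le_antisymm hz1 hz2
    subst this
    exact hdisj ⟨z, ⟨le_rfl, by linarith⟩, by simpa [sLift] using hu0, hz⟩
  have hz : ∀ j : ℕ, ∃ z, (∀ x ∈ S, ¬ reach A u0 (j + 1) x → x < z) ∧
      (∀ x ∈ S, reach A u0 (j + 1) x → z < x) ∧ u0 < z ∧ z < u0 + Real.pi := by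
    intro j
    obtain ⟨z, h1, h2⟩ := exists_between_finite {x ∈ S | ¬ reach A u0 (j + 1) x}
      (insert (u0 + Real.pi) {x ∈ S | reach A u0 (j + 1) x})
      (hS.subset (sep_subset _ _)) ((hS.subset (sep_subset _ _)).insert _) ⟨u0, hu0S, hreach1 j⟩ ⟨_, mem_insert _ _⟩
      (by
        rintro x ⟨hx, hxr⟩ y (rfl | ⟨hy, hyr⟩)
        · exact (hSI x hx).2
        · by_contra hle
          exact hxr (reach_mono (not_lt.1 hle) hyr))
    exact ⟨z, fun x hx hr => h1 x ⟨hx, hr⟩, fun x hx hr => h2 x (Or.inr ⟨hx, hr⟩),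
      h1 u0 ⟨hu0S, hreach1 j⟩, h2 _ (mem_insert _ _)⟩
  choose z hz1 hz2 hz3 hz4 using hz
  obtain ⟨a, ha⟩ := prod_sin_mem n z
  -- sign on S
  have hsign : ∀ x ∈ S, ∃ c : ℕ, 0 < (-1) ^ c * frm n a x ∧ x ∉ sLift A (c + 1) := by
    intro x hx
    have hxI := hSI x hx
    classical
    have hex : ∃ c, ¬ reach A u0 (c + 1) x := ⟨n, hC x hxI.2⟩
    let c := Nat.find hex
    have hc : ¬ reach A u0 (c + 1) x := Nat.find_spec hex
    have hcn : c ≤ n := Nat.find_min' hex (hC x hxI.2)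
    have hlt : ∀ j < c, reach A u0 (j + 1) x := fun j hj => not_not.1 (Nat.find_min hex hj)
    refine ⟨c, ?_, ?_⟩
    · rw [← ha]
      refine prod_sign n c _ hcn ?_ ?_
      · intro j hj
        have := hz2 j x hx (hlt j hj)
        exact Real.sin_neg_of_neg_of_neg_pi_lt (by linarith) (by linarith [hz3 j, hxI.2])
      · intro j hj _
        have := hz1 j x hx (fun h => hc (reach_of_le (by omega) h))
        exact Real.sin_pos_of_pos_of_lt_pi (by linarith) (by linarith [hz4 j, hxI.1])
    · intro hxc
      apply hc
      refine ⟨x, hxc, le_rfl, ?_⟩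
      rcases Nat.eq_zero_or_pos c with h0 | h0
      · rw [h0]; exact hxI.1
      · have := hlt (c - 1) (by omega)
        rwa [Nat.sub_add_cancel h0] at this
  have hsign' : ∀ x ∈ Ico u0 (u0 + Real.pi), (x ∈ sLift A 0 → 0 < frm n a x) ∧ (x ∈ sLift A 1 → frm n a x < 0) := by
    intro x hxI
    constructor
    · intro hx
      obtain ⟨c, h1, h2⟩ := hsign x (Or.inl ⟨hx, hxI⟩)
      rcases Nat.even_or_odd c with he | ho
      · simpa [he.neg_one_pow] using h1
      · exact absurd (by rwa [sLift_parity A (j := 0) (by have := Nat.odd_iff.1 ho; omega)]) h2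
    · intro hx
      obtain ⟨c, h1, h2⟩ := hsign x (Or.inr ⟨hx, hxI⟩)
      rcases Nat.even_or_odd c with he | ho
      · exact absurd (by rwa [sLift_parity A (j := 1) (by have := Nat.even_iff.1 he; omega)]) h2
      · rw [ho.neg_one_pow] at h1; linarith
  refine ⟨a, fun c hc => ?_⟩
  obtain ⟨x, hx, rfl⟩ := circ_rep_Ico u0 c
  rw [frmC_coe]
  rcases lt_or_ge x (u0 + Real.pi) with h | h
  · exact (hsign' x ⟨hx.1, h⟩).1 (by simpa [sLift] using hc)
  · have := (hsign' (x - Real.pi) ⟨by linarith, by linarith [hx.2]⟩).2 (by simpa [sLift] using hc)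
    have e := frm_anti hn a (x - Real.pi)
    rw [sub_add_cancel] at e
    linarith

/-- The condition holds for sets of small diameter. -/
lemma reach_gap {A : Set Circ} {r : ℝ} (hd : ∀ x ∈ A, ∀ y ∈ A, dist x y ≤ r) (u0 : ℝ) (hu0 : (u0 : Circ) ∈ A)
    (hr : r < Real.pi) (j : ℕ) : ∀ x, reach A u0 j x →
      ∃ y ∈ sLift A j, y ≤ x ∧ u0 + j * (Real.pi - r) ≤ y := by
  induction j with
  | zero =>
    intro x hx
    exact ⟨u0, by simpa [sLift] using hu0, hx, by simp⟩
  | succ j ih =>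
    rintro x ⟨y, hy, hyx, hr'⟩
    obtain ⟨w, hw, hwy, hw'⟩ := ih y hr'
    refine ⟨y, hy, hyx, ?_⟩
    have := (circ_dist_le_iff _ _ r).1 (hd _ hy _ hw) 0
    push_cast at this
    rw [show y + (j + 1) * Real.pi - (w + j * Real.pi + (2 * 0 + 1) * Real.pi) = y - w by ring,
      abs_of_nonneg (by linarith)] at this
    push_cast
    linarith

lemma exists_pos_form_of_diam {n : ℕ} (hn : Odd n) {A : Set Circ} (hA : A.Finite) (hne : A.Nonempty) {r : ℝ}
    (hd : ∀ x ∈ A, ∀ y ∈ A, dist x y ≤ r) (hr : Real.pi / (n + 2) < Real.pi - r) :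
    ∃ a, ∀ x ∈ A, 0 < frmC n a x := by
  obtain ⟨c, hc⟩ := hne
  obtain ⟨u0, rfl⟩ := QuotientAddGroup.mk_surjective c
  have hp := Real.pi_pos
  have hpos : 0 < Real.pi / (n + 2) := by positivity
  refine exists_pos_form hn hA u0 hc ?_
  intro x hx h
  obtain ⟨y, hy, hyx, hy'⟩ := reach_gap hd u0 hc (by linarith) (n + 1) x h
  rw [sLift_parity A (j := 0) (by have := Nat.odd_iff.1 hn; omega)] at hy
  have hy0 : (y : Circ) ∈ A := by simpa [sLift] using hy
  have := (circ_dist_le_iff _ _ r).1 (hd _ hy0 _ hc) 0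
  push_cast at this hy'
  rw [abs_of_nonpos (by linarith)] at this
  rw [div_lt_iff₀ (by positivity)] at hr
  nlinarith

/-- The condition holds for images under `TC`. -/
lemma exists_pos_form_TC {n : ℕ} {a : EuclideanSpace ℝ (Fin (n + 1))} {ε : ℝ} (h : Adm n a ε)
    {t : ℝ} (ht : t ∈ Icc (0:ℝ) 1) {B : Set Circ} (hB : B.Finite) (hne : B.Nonempty)
    (hpos : ∀ x ∈ B, ε ≤ frmC n a x) : ∃ b, ∀ x ∈ B, 0 < frmC n b (TC n a ε t x) := by
  obtain ⟨c, hc⟩ := hne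
  obtain ⟨x0, rfl⟩ := QuotientAddGroup.mk_surjective c
  have hp := Real.pi_pos
  have hA : (TC n a ε t '' B).Finite := hB.image _
  -- description of signed lifts
  have hl : ∀ j, ∀ y ∈ sLift (TC n a ε t '' B) j, ∃ x, y = Tl n a ε t x ∧ ε ≤ (-1) ^ j * frm n a x := by
    rintro j y ⟨b, hb, hby⟩
    obtain ⟨b, rfl⟩ := QuotientAddGroup.mk_surjective b
    have e := h.TC_coe t b
    change TC n a ε t (b : Circ) = _ at hby
    rw [e, eq_comm, circ_eq_iff] at hby
    obtain ⟨m, hm⟩ := hby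
    refine ⟨b + (2 * m - j : ℤ) * Real.pi, ?_, ?_⟩
    · rw [h.Tl_add_int]; push_cast; linarith
    · have hb' : ε ≤ frm n a b := hpos _ hb
      have : frm n a (b + (2 * m - j : ℤ) * Real.pi) = (-1) ^ j * frm n a b := by
        have e1 : ∀ j : ℕ, frm n a (b - j * Real.pi) = (-1) ^ j * frm n a b := by
          intro j
          induction j with
          | zero => simp
          | succ j ih =>
            have := frm_anti h.odd a (b - (j + 1) * Real.pi)
            rw [show b - (j + 1) * Real.pi + Real.pi = b - j * Real.pi by ring, ih] at this
            push_cast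
            rw [pow_succ]; linarith
        rw [← e1 j, ← (frm_per n a).int_mul m (b - j * Real.pi)]
        congr 1; push_cast; ring
      rw [this, ← mul_assoc, ← mul_pow]; simpa using hb'
  have hx0 : ε ≤ frm n a x0 := hpos _ hc
  have main : ∀ j y, reach (TC n a ε t '' B) (Tl n a ε t x0) j y →
      ∃ x, Tl n a ε t x ≤ y ∧ ε ≤ (-1) ^ j * frm n a x ∧ x0 ≤ x ∧
      ∃ Z : Finset ℝ, Z.card = j ∧ ∀ w ∈ Z, w ∈ Ico x0 x ∧ frm n a w = 0 := by
    intro j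
    induction j with
    | zero =>
      intro y hy
      exact ⟨x0, hy, by simpa using hx0, le_rfl, ∅, rfl, by simp⟩
    | succ j ih =>
      rintro y ⟨y', hy', hyy, hr⟩
      obtain ⟨x', rfl, hx'⟩ := hl _ _ hy'
      obtain ⟨x, hxy, hx, hx0x, Z, hZc, hZ⟩ := ih _ hr
      have hcr : (ε ≤ frm n a x ∧ frm n a x' ≤ -ε) ∨ (ε ≤ frm n a x' ∧ frm n a x ≤ -ε) := by
        rw [pow_succ] at hx'
        rcases neg_one_pow_eq_or ℝ j with e | e
        · rw [e] at hx hx'; left; constructor <;> linarith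
        · rw [e] at hx hx'; right; constructor <;> linarith
      have hlt := h.cross_lt hcr ht hxy
      have heps := h.pos
      obtain ⟨w, hw, hw0⟩ : ∃ w ∈ Icc x x', frm n a w = 0 := by
        rcases hcr with hcr | hcr
        · exact intermediate_value_Icc' hlt.le (frm_cont' n a).continuousOn ⟨by linarith [hcr.2], by linarith [hcr.1]⟩
        · exact intermediate_value_Icc hlt.le (frm_cont' n a).continuousOn ⟨by linarith [hcr.2], by linarith [hcr.1]⟩
      have hwx' : w ≠ x' := by
        rintro rfl
        rcases hcr with hcr | hcr <;> linarith [hcr.1, hcr.2]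
      refine ⟨x', hyy, hx', by linarith, insert w Z, ?_, ?_⟩
      · rw [Finset.card_insert_of_notMem, hZc]
        intro hwZ
        have := (hZ w hwZ).1.2
        linarith [hw.1]
      · intro v hv
        rcases Finset.mem_insert.1 hv with rfl | hv
        · exact ⟨⟨by linarith [hw.1], lt_of_le_of_ne hw.2 hwx'⟩, hw0⟩
        · exact ⟨⟨(hZ v hv).1.1, by linarith [(hZ v hv).1.2]⟩, (hZ v hv).2⟩
  obtain ⟨b, hb⟩ := exists_pos_form h.odd hA (Tl n a ε t x0)
    ⟨_, hc, h.TC_coe t x0⟩ (by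
      intro y hy hr
      obtain ⟨x, hx, -, hx0', Z, hZc, hZ⟩ := main _ _ hr
      have hxlt : x < x0 + Real.pi := by
        by_contra hge
        have := h.Tl_mono ht (not_lt.1 hge)
        rw [h.Tl_add_pi] at this
        linarith
      have := frm_card_zeros n a h.ne x0 Z (fun w hw => ⟨⟨(hZ w hw).1.1, by linarith [(hZ w hw).1.2]⟩, (hZ w hw).2⟩)
      omega)
  exact ⟨b, fun x hx => hb _ ⟨x, hx, rfl⟩⟩

/-- Probability measures on the circle. -/
abbrev PM : Type := ProbabilityMeasure Circ

/-- Bundle a probability measure. -/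
def mkPM (μ : Measure Circ) (h : IsProbabilityMeasure μ) : PM := ⟨μ, h⟩

lemma mkPM_toMeasure (μ : Measure Circ) (h : IsProbabilityMeasure μ) : (mkPM μ h).toMeasure = μ := rfl

lemma intg_of_cont (μ : PM) {φ : Circ → ℝ} (h : Continuous φ) : Integrable φ μ.toMeasure :=
  h.integrable_of_hasCompactSupport (HasCompactSupport.of_compactSpace φ)

/-- `μ` is carried by `A`. -/
def Car (μ : PM) (A : Set Circ) : Prop := μ.toMeasure Aᶜ = 0

lemma Car.mono {μ : PM} {A B : Set Circ} (h : Car μ A) (hAB : A ⊆ B) : Car μ B :=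
  measure_mono_null (compl_subset_compl.2 hAB) h

lemma Car.ae {μ : PM} {A : Set Circ} (h : Car μ A) : ∀ᵐ x ∂μ.toMeasure, x ∈ A := h

lemma Car.nonempty {μ : PM} {A : Set Circ} (h : Car μ A) : A.Nonempty := by
  by_contra hA
  rw [not_nonempty_iff_eq_empty] at hA
  subst hA
  simp [Car] at h

lemma VRm_of_car {μ : PM} {A : Set Circ} {r : ℝ} (hA : A.Finite) (h : Car μ A)
    (hd : ∀ x ∈ A, ∀ y ∈ A, dist x y ≤ r) : μ ∈ VRm Circ r := by
  refine ⟨⟨hA.toFinset, ?_⟩, ?_⟩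
  · rw [hA.coe_toFinset]
    exact (prob_compl_eq_zero_iff hA.measurableSet).1 h
  · have hs : mSupport μ ⊆ A := by
      intro x hx
      by_contra hxA
      exact hx (measure_mono_null (singleton_subset_iff.2 hxA) h)
    obtain ⟨x, hx⟩ := h.nonempty
    have h0 : 0 ≤ r := dist_nonneg.trans (hd x hx x hx)
    exact Metric.diam_le_of_forall_dist_le h0 fun x hx y hy => hd x (hs hx) y (hs hy)

lemma car_of_VRm {μ : PM} {r : ℝ} (h : μ ∈ VRm Circ r) :
    (mSupport μ).Finite ∧ Car μ (mSupport μ) ∧ ∀ x ∈ mSupport μ, ∀ y ∈ mSupport μ, dist x y ≤ r := by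
  obtain ⟨⟨S, hS⟩, hd⟩ := h
  have hS' : μ.toMeasure (↑S : Set Circ)ᶜ = 0 := (prob_compl_eq_zero_iff S.finite_toSet.measurableSet).2 hS
  have hsub : mSupport μ ⊆ S := by
    intro x hx
    by_contra hxA
    exact hx (measure_mono_null (singleton_subset_iff.2 hxA) hS')
  have hf : (mSupport μ).Finite := S.finite_toSet.subset hsub
  refine ⟨hf, ?_, fun x hx y hy => (Metric.dist_le_diam_of_mem hf.isBounded hx hy).trans hd⟩
  have h1 : (mSupport μ)ᶜ ⊆ (↑S : Set Circ)ᶜ ∪ (↑S \ mSupport μ) := by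
    intro x hx
    by_cases hxS : x ∈ (↑S : Set Circ)
    · exact Or.inr ⟨hxS, hx⟩
    · exact Or.inl hxS
  refine measure_mono_null h1 (measure_union_null hS' ?_)
  rw [measure_null_iff_singleton ((S.finite_toSet.subset sdiff_subset).countable)]
  intro x hx
  by_contra hne
  exact hx.2 hne

lemma Car.integral_pos {μ : PM} {A : Set Circ} (h : Car μ A) {φ : Circ → ℝ} (hφ : Continuous φ)
    (hp : ∀ x ∈ A, 0 < φ x) : 0 < ∫ x, φ x ∂μ.toMeasure := by
  rw [integral_pos_iff_support_of_nonneg_ae (h.ae.mono fun x hx => (hp x hx).le) (intg_of_cont μ hφ)]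
  have : μ.toMeasure (Function.support φ) = 1 := by
    rw [← prob_compl_eq_zero_iff (hφ.isOpen_support.measurableSet)]
    refine measure_mono_null (compl_subset_compl.2 ?_) h
    intro x hx
    exact (hp x hx).ne'
  rw [this]; exact one_pos

/-- Joint continuity of integration. -/
lemma cont_integral {Z : Type*} [TopologicalSpace Z] {m : Z → PM} (hm : Continuous m)
    {φ : Z → Circ → ℝ} (hφ : Continuous fun q : Z × Circ => φ q.1 q.2) :
    Continuous fun z => ∫ x, φ z x ∂(m z).toMeasure := by
  let Φ : C(Z × Circ, ℝ) := ⟨fun q => φ q.1 q.2, hφ⟩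
  rw [continuous_iff_continuousAt]
  intro z0
  have h1 : Filter.Tendsto (fun z => ∫ x, φ z0 x ∂(m z).toMeasure) (nhds z0) (nhds (∫ x, φ z0 x ∂(m z0).toMeasure)) :=
    ((ProbabilityMeasure.continuous_integral_continuousMap (Φ.curry z0)).comp hm).tendsto z0
  have h2 : Filter.Tendsto (fun z => dist (Φ.curry z) (Φ.curry z0)) (nhds z0) (nhds 0) := by
    have := (Φ.curry.continuous.tendsto z0)
    rwa [tendsto_iff_dist_tendsto_zero] at this
  have h3 : Filter.Tendsto (fun z => (∫ x, φ z x ∂(m z).toMeasure) - ∫ x, φ z0 x ∂(m z).toMeasure) (nhds z0) (nhds 0) := by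
    refine squeeze_zero_norm (fun z => ?_) h2
    have e := integral_sub (intg_of_cont (m z) (Φ.curry z).continuous) (intg_of_cont (m z) (Φ.curry z0).continuous)
    have e' : (∫ x, φ z x ∂(m z).toMeasure) - ∫ x, φ z0 x ∂(m z).toMeasure =
      ∫ x, (Φ.curry z x - Φ.curry z0 x) ∂(m z).toMeasure := e.symm
    rw [e']
    refine (norm_integral_le_of_norm_le_const (C := dist (Φ.curry z) (Φ.curry z0)) ?_).trans (by simp)
    filter_upwards with x
    rw [← dist_eq_norm]
    exact ContinuousMap.dist_apply_le_dist x
  have := h3.add h1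
  simpa [ContinuousAt] using this

lemma cont_PM {Z : Type*} [TopologicalSpace Z] {m : Z → PM}
    (h : ∀ ψ : C(Circ, ℝ), Continuous fun z => ∫ x, ψ x ∂(m z).toMeasure) : Continuous m :=
  ProbabilityMeasure.continuous_iff_forall_continuousMap_continuous_integral.2 h

open Classical in
/-- Push-forward. -/
def push (T : Circ → Circ) (μ : PM) : PM :=
  if h : Continuous T then μ.map h.measurable.aemeasurable else μ

lemma push_integral {T : Circ → Circ} (hT : Continuous T) (μ : PM) {ψ : Circ → ℝ} (hψ : Continuous ψ) :
    ∫ x, ψ x ∂(push T μ).toMeasure = ∫ x, ψ (T x) ∂μ.toMeasure := by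
  rw [push, dif_pos hT, ProbabilityMeasure.toMeasure_map,
    integral_map hT.measurable.aemeasurable hψ.aestronglyMeasurable]

lemma push_car {T : Circ → Circ} (hT : Continuous T) {μ : PM} {A : Set Circ} (hA : A.Finite) (h : Car μ A) :
    Car (push T μ) (T '' A) := by
  rw [Car, push, dif_pos hT, ProbabilityMeasure.toMeasure_map,
    Measure.map_apply hT.measurable (hA.image T).measurableSet.compl]
  refine measure_mono_null ?_ h
  intro x hx hxA
  exact hx ⟨x, hxA, rfl⟩

lemma push_id {T : Circ → Circ} (hT : ∀ x, T x = x) (μ : PM) : push T μ = μ := by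
  have : T = id := funext hT
  subst this
  apply ProbabilityMeasure.toMeasure_injective
  rw [push, dif_pos continuous_id, ProbabilityMeasure.toMeasure_map, Measure.map_id]

lemma push_cont {Z : Type*} [TopologicalSpace Z] {m : Z → PM} (hm : Continuous m)
    {T : Z → Circ → Circ} (hT : Continuous fun q : Z × Circ => T q.1 q.2) :
    Continuous fun z => push (T z) (m z) := by
  refine cont_PM fun ψ => ?_
  have hz : ∀ z, Continuous (T z) := fun z => hT.comp (Continuous.prodMk_right z)
  simp_rw [push_integral (hz _) _ ψ.continuous]
  exact cont_integral hm (ψ.continuous.comp hT)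

open Classical in
/-- Convex combination. -/
def mix (t : ℝ) (μ ν : PM) : PM :=
  if h : t ∈ Icc (0 : ℝ) 1 then mkPM (ENNReal.ofReal (1 - t) • μ.toMeasure + ENNReal.ofReal t • ν.toMeasure) ⟨by
    simp only [Measure.coe_add, Measure.coe_smul, Pi.add_apply, Pi.smul_apply, measure_univ, smul_eq_mul, mul_one]
    rw [← ENNReal.ofReal_add (by linarith [h.2]) h.1]; simp⟩ else μ

lemma mix_toMeasure {t : ℝ} (h : t ∈ Icc (0 : ℝ) 1) (μ ν : PM) :
    (mix t μ ν).toMeasure = ENNReal.ofReal (1 - t) • μ.toMeasure + ENNReal.ofReal t • ν.toMeasure := by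
  rw [mix, dif_pos h, mkPM_toMeasure]

lemma mix_zero (μ ν : PM) : mix 0 μ ν = μ := by
  apply ProbabilityMeasure.toMeasure_injective
  rw [mix_toMeasure (by simp)]; simp

lemma mix_one (μ ν : PM) : mix 1 μ ν = ν := by
  apply ProbabilityMeasure.toMeasure_injective
  rw [mix_toMeasure (by simp)]; simp

lemma mix_car {t : ℝ} (h : t ∈ Icc (0 : ℝ) 1) {μ ν : PM} {A : Set Circ} (hμ : Car μ A) (hν : Car ν A) :
    Car (mix t μ ν) A := by
  rw [Car, mix_toMeasure h]
  simp only [Car] at hμ hν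
  simp [hμ, hν]

lemma mix_integral {t : ℝ} (h : t ∈ Icc (0 : ℝ) 1) (μ ν : PM) {ψ : Circ → ℝ} (hψ : Continuous ψ) :
    ∫ x, ψ x ∂(mix t μ ν).toMeasure = (1 - t) * ∫ x, ψ x ∂μ.toMeasure + t * ∫ x, ψ x ∂ν.toMeasure := by
  rw [mix_toMeasure h, integral_add_measure
    ((intg_of_cont μ hψ).smul_measure ENNReal.ofReal_ne_top) ((intg_of_cont ν hψ).smul_measure ENNReal.ofReal_ne_top),
    integral_smul_measure, integral_smul_measure, ENNReal.toReal_ofReal (by linarith [h.2]), ENNReal.toReal_ofReal h.1]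
  rfl

lemma mix_cont {Z : Type*} [TopologicalSpace Z] {m m' : Z → PM} (hm : Continuous m) (hm' : Continuous m')
    {t : Z → ℝ} (ht : Continuous t) (h : ∀ z, t z ∈ Icc (0 : ℝ) 1) :
    Continuous fun z => mix (t z) (m z) (m' z) := by
  refine cont_PM fun ψ => ?_
  simp_rw [mix_integral (h _) _ _ ψ.continuous]
  have h1 := cont_integral hm (φ := fun _ x => ψ x) (ψ.continuous.comp continuous_snd)
  have h2 := cont_integral hm' (φ := fun _ x => ψ x) (ψ.continuous.comp continuous_snd)
  fun_prop

open Classical in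
/-- Reweighting by a nonnegative density. -/
def rew (φ : Circ → ℝ) (μ : PM) : PM :=
  if h : Continuous φ ∧ (∀ x, 0 ≤ φ x) ∧ 0 < ∫ x, φ x ∂μ.toMeasure then
    mkPM (μ.toMeasure.withDensity (fun x => ENNReal.ofReal (φ x / ∫ x, φ x ∂μ.toMeasure))) ⟨by
      rw [withDensity_apply _ MeasurableSet.univ, Measure.restrict_univ,
        ← ofReal_integral_eq_lintegral_ofReal ((intg_of_cont μ h.1).div_const _)
        (Filter.Eventually.of_forall fun x => div_nonneg (h.2.1 x) h.2.2.le), integral_div, div_self h.2.2.ne']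
      simp⟩ else μ

lemma rew_toMeasure {φ : Circ → ℝ} {μ : PM} (h : Continuous φ) (h0 : ∀ x, 0 ≤ φ x) (hp : 0 < ∫ x, φ x ∂μ.toMeasure) :
    (rew φ μ).toMeasure = μ.toMeasure.withDensity (fun x => ENNReal.ofReal (φ x / ∫ x, φ x ∂μ.toMeasure)) := by
  rw [rew, dif_pos ⟨h, h0, hp⟩, mkPM_toMeasure]

lemma rew_integral {φ : Circ → ℝ} {μ : PM} (h : Continuous φ) (h0 : ∀ x, 0 ≤ φ x) (hp : 0 < ∫ x, φ x ∂μ.toMeasure)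
    (ψ : Circ → ℝ) :
    ∫ x, ψ x ∂(rew φ μ).toMeasure = (∫ x, φ x * ψ x ∂μ.toMeasure) / ∫ x, φ x ∂μ.toMeasure := by
  rw [rew_toMeasure h h0 hp, integral_withDensity_eq_integral_toReal_smul
    ((h.div_const _).measurable.ennreal_ofReal) (by simp), ← integral_div]
  refine integral_congr_ae (Filter.Eventually.of_forall fun x => ?_)
  simp only [smul_eq_mul]
  rw [ENNReal.toReal_ofReal (div_nonneg (h0 x) hp.le)]
  ring

lemma rew_car {φ : Circ → ℝ} {μ : PM} (h : Continuous φ) (h0 : ∀ x, 0 ≤ φ x) (hp : 0 < ∫ x, φ x ∂μ.toMeasure)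
    {A : Set Circ} (hA : A.Finite) (hμ : Car μ A) : Car (rew φ μ) {x ∈ A | 0 < φ x} := by
  rw [Car, rew_toMeasure h h0 hp, withDensity_apply _ (hA.subset (sep_subset _ _)).measurableSet.compl,
    lintegral_eq_zero_iff ((h.div_const _).measurable.ennreal_ofReal)]
  rw [Filter.EventuallyEq, ae_restrict_iff' (hA.subset (sep_subset _ _)).measurableSet.compl]
  filter_upwards [hμ.ae] with x hx hx'
  have : φ x = 0 := by
    by_contra hne
    exact hx' ⟨hx, lt_of_le_of_ne (h0 x) (Ne.symm hne)⟩
  simp [this]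

lemma rew_cont {Z : Type*} [TopologicalSpace Z] {m : Z → PM} (hm : Continuous m)
    {φ : Z → Circ → ℝ} (hφ : Continuous fun q : Z × Circ => φ q.1 q.2) (h0 : ∀ z x, 0 ≤ φ z x)
    (hp : ∀ z, 0 < ∫ x, φ z x ∂(m z).toMeasure) : Continuous fun z => rew (φ z) (m z) := by
  refine cont_PM fun ψ => ?_
  have hz : ∀ z, Continuous (φ z) := fun z => hφ.comp (Continuous.prodMk_right z)
  simp_rw [rew_integral (hz _) (h0 _) (hp _)]
  refine Continuous.div (cont_integral hm (φ := fun z x => φ z x * ψ x) (hφ.mul (ψ.continuous.comp continuous_snd)))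
    (cont_integral hm hφ) fun z => (hp z).ne'

lemma frmC_sum (n : ℕ) (a : EuclideanSpace ℝ (Fin (n + 1))) (x : Circ) :
    frmC n a x = ∑ i, a i * frmC n (EuclideanSpace.single i 1) x := by
  obtain ⟨x, rfl⟩ := QuotientAddGroup.mk_surjective x
  change frm n a x = ∑ i, a i * frm n (EuclideanSpace.single i 1) x
  unfold frm
  refine Finset.sum_congr rfl fun i _ => ?_
  congr 1
  rw [Finset.sum_eq_single i]
  · simp
  · intro j _ hj; simp [hj]
  · simp

/-- The moment vector. -/
def mom (n : ℕ) (μ : PM) : EuclideanSpace ℝ (Fin (n + 1)) :=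
  WithLp.toLp 2 fun i => ∫ x, frmC n (EuclideanSpace.single i 1) x ∂μ.toMeasure

lemma mom_inner (n : ℕ) (μ : PM) (a : EuclideanSpace ℝ (Fin (n + 1))) :
    inner ℝ a (mom n μ) = ∫ x, frmC n a x ∂μ.toMeasure := by
  simp_rw [frmC_sum n a]
  rw [integral_finset_sum _ fun i _ => (intg_of_cont μ (frmC_cont' n _)).const_mul _]
  simp_rw [integral_const_mul]
  rw [PiLp.inner_apply]
  refine Finset.sum_congr rfl fun i _ => ?_
  simp [mom, mul_comm]

lemma mom_cont {Z : Type*} [TopologicalSpace Z] (n : ℕ) {m : Z → PM} (hm : Continuous m) :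
    Continuous fun z => mom n (m z) := by
  refine (PiLp.continuous_toLp 2 _).comp (continuous_pi fun i => ?_)
  exact cont_integral hm (φ := fun _ x => frmC n (EuclideanSpace.single i 1) x) ((frmC_cont' n _).comp continuous_snd)

lemma mom_ne {n : ℕ} {μ : PM} {A : Set Circ} (h : Car μ A) {a : EuclideanSpace ℝ (Fin (n + 1))}
    (hp : ∀ x ∈ A, 0 < frmC n a x) : mom n μ ≠ 0 := by
  intro h0
  have := h.integral_pos (frmC_cont' n a) hp
  rw [← mom_inner, h0, inner_zero_right] at this
  exact lt_irrefl _ this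

/-- The cut-off level. -/
def eps (n : ℕ) (a : EuclideanSpace ℝ (Fin (n + 1))) (μ : PM) : ℝ :=
  (∫ x, max (frmC n a x) 0 ∂μ.toMeasure) / 2

/-- The cut-off density. -/
def phi (n : ℕ) (a : EuclideanSpace ℝ (Fin (n + 1))) (ε : ℝ) (x : Circ) : ℝ := max (frmC n a x - ε) 0

lemma phi_cont' (n : ℕ) (a : EuclideanSpace ℝ (Fin (n + 1))) (ε : ℝ) : Continuous (phi n a ε) := by
  have := frmC_cont' n a
  unfold phi; fun_prop

lemma phi_nonneg (n : ℕ) (a : EuclideanSpace ℝ (Fin (n + 1))) (ε : ℝ) (x) : 0 ≤ phi n a ε x := le_max_right _ _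

/-- Reweighting by the cut-off density. -/
def Rw (n : ℕ) (a : EuclideanSpace ℝ (Fin (n + 1))) (μ : PM) : PM := rew (phi n a (eps n a μ)) μ

section
variable {n : ℕ} {a : EuclideanSpace ℝ (Fin (n + 1))} {μ : PM}

lemma phi_int_pos (h : 0 < eps n a μ) : 0 < ∫ x, phi n a (eps n a μ) x ∂μ.toMeasure := by
  have hc : Continuous fun x => max (frmC n a x) 0 := (frmC_cont' n a).max continuous_const
  have h1 : ∫ x, (max (frmC n a x) 0 - eps n a μ) ∂μ.toMeasure ≤ ∫ x, phi n a (eps n a μ) x ∂μ.toMeasure := by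
    refine integral_mono (intg_of_cont μ (hc.sub continuous_const)) (intg_of_cont μ (phi_cont' n a _)) fun x => ?_
    simp only [phi]
    rcases le_total (frmC n a x) 0 with h' | h'
    · rw [max_eq_right h']; exact le_max_of_le_right (by linarith)
    · rw [max_eq_left h']; exact le_max_left _ _
  rw [integral_sub (intg_of_cont μ hc) (intg_of_cont μ continuous_const)] at h1
  simp only [integral_const, probReal_univ, one_smul] at h1
  have h2 : ∫ x, max (frmC n a x) 0 ∂μ.toMeasure = 2 * eps n a μ := by unfold eps; ring
  linarith

lemma Rw_car (h : 0 < eps n a μ) {A : Set Circ} (hA : A.Finite) (hμ : Car μ A) :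
    Car (Rw n a μ) {x ∈ A | eps n a μ ≤ frmC n a x} := by
  refine (rew_car (phi_cont' n a _) (phi_nonneg n a _) (phi_int_pos h) hA hμ).mono ?_
  rintro x ⟨hx, hx'⟩
  refine ⟨hx, ?_⟩
  rcases lt_max_iff.1 hx' with h' | h'
  · linarith
  · exact absurd h' (lt_irrefl _)

lemma eps_adm (hn : Odd n) (ha : a ≠ 0) {ε : ℝ} (hε : 0 < ε) (h : ε ≤ eps n a μ) : Adm n a ε := by
  refine ⟨hn, hε, ha, ?_⟩
  by_contra hcon
  push Not at hcon
  have hc : Continuous fun x => max (frmC n a x) 0 := (frmC_cont' n a).max continuous_const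
  have h1 : ∫ x, max (frmC n a x) 0 ∂μ.toMeasure ≤ ∫ _, ε ∂μ.toMeasure := by
    refine integral_mono (intg_of_cont μ hc) (intg_of_cont μ continuous_const) fun x => ?_
    obtain ⟨x, rfl⟩ := QuotientAddGroup.mk_surjective x
    exact max_le (hcon x).le hε.le
  simp only [integral_const, probReal_univ, one_smul] at h1
  unfold eps at h
  linarith

lemma eps_pos_of_integral (h : 0 < ∫ x, frmC n a x ∂μ.toMeasure) : 0 < eps n a μ := by
  have hc : Continuous fun x => max (frmC n a x) 0 := (frmC_cont' n a).max continuous_const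
  have := integral_mono (intg_of_cont μ (frmC_cont' n a)) (intg_of_cont μ hc) fun x => le_max_left _ _
  unfold eps; linarith

lemma eps_pos_of_mom (h : mom n μ ≠ 0) : 0 < eps n (‖mom n μ‖⁻¹ • mom n μ) μ := by
  apply eps_pos_of_integral
  rw [← mom_inner, real_inner_smul_left, real_inner_self_eq_norm_sq]
  have := norm_pos_iff.2 h
  positivity
end

lemma eps_cont {Z : Type*} [TopologicalSpace Z] {n : ℕ} {a : Z → EuclideanSpace ℝ (Fin (n + 1))} {m : Z → PM}
    (ha : Continuous a) (hm : Continuous m) : Continuous fun z => eps n (a z) (m z) := by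
  unfold eps
  refine Continuous.div_const (cont_integral hm (φ := fun z x => max (frmC n (a z) x) 0) ?_) 2
  refine Continuous.max ?_ continuous_const
  exact (frmC_cont n).comp ((ha.comp continuous_fst).prodMk continuous_snd)

lemma Rw_cont {Z : Type*} [TopologicalSpace Z] {n : ℕ} {a : Z → EuclideanSpace ℝ (Fin (n + 1))} {m : Z → PM}
    (ha : Continuous a) (hm : Continuous m) (h : ∀ z, 0 < eps n (a z) (m z)) :
    Continuous fun z => Rw n (a z) (m z) := by
  unfold Rw
  refine rew_cont hm ?_ (fun z => phi_nonneg n _ _) (fun z => phi_int_pos (h z))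
  unfold phi
  refine Continuous.max (Continuous.sub ?_ ((eps_cont ha hm).comp continuous_fst)) continuous_const
  exact (frmC_cont n).comp ((ha.comp continuous_fst).prodMk continuous_snd)

/-- The grid angles. -/
def gth (n : ℕ) (j : Fin (n + 1)) : ℝ := Real.pi * j.1 / (n + 1)

/-- The grid measure. -/
lemma exists_grid (n : ℕ) (hn : Odd n) : ∃ (β : PM) (B : Set Circ), B.Finite ∧ Car β B ∧
    ∀ a : EuclideanSpace ℝ (Fin (n + 1)), a ≠ 0 → 0 < eps n a β := by
  set c : ℝ≥0∞ := ((2 * (n + 1) : ℕ) : ℝ≥0∞)⁻¹ with hcdef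
  have hc0 : ((2 * (n + 1) : ℕ) : ℝ≥0∞) ≠ 0 := by
    rw [Nat.cast_ne_zero]; omega
  have hct : ((2 * (n + 1) : ℕ) : ℝ≥0∞) ≠ ⊤ := ENNReal.natCast_ne_top _
  let ν : Measure Circ := ∑ j : Fin (n + 1), (Measure.dirac ((gth n j : ℝ) : Circ) + Measure.dirac ((gth n j + Real.pi : ℝ) : Circ))
  have hν : IsProbabilityMeasure (c • ν) := ⟨by
    have : ν univ = ((2 * (n + 1) : ℕ) : ℝ≥0∞) := by
      simp only [ν, Measure.coe_finset_sum, Finset.sum_apply, Measure.coe_add, Pi.add_apply, measure_univ]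
      rw [Finset.sum_const, Finset.card_univ, Fintype.card_fin, nsmul_eq_mul]
      push_cast; ring
    rw [Measure.smul_apply, this, smul_eq_mul, hcdef, ENNReal.inv_mul_cancel hc0 hct]⟩
  let B : Set Circ := (range fun j => ((gth n j : ℝ) : Circ)) ∪ (range fun j => ((gth n j + Real.pi : ℝ) : Circ))
  have hB : B.Finite := (finite_range _).union (finite_range _)
  refine ⟨mkPM (c • ν) hν, B, hB, ?_, ?_⟩
  · rw [Car, mkPM_toMeasure]
    have : ν Bᶜ = 0 := by
      simp only [ν, Measure.coe_finset_sum, Finset.sum_apply, Measure.coe_add, Pi.add_apply]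
      refine Finset.sum_eq_zero fun j _ => ?_
      rw [Measure.dirac_apply' _ hB.measurableSet.compl, Measure.dirac_apply' _ hB.measurableSet.compl,
        indicator_of_notMem, indicator_of_notMem, add_zero]
      · exact fun h => h (Or.inr ⟨j, rfl⟩)
      · exact fun h => h (Or.inl ⟨j, rfl⟩)
    rw [Measure.smul_apply, this, smul_zero]
  · intro a ha
    have hcont : Continuous fun x => max (frmC n a x) 0 := (frmC_cont' n a).max continuous_const
    have hi : ∀ y : Circ, Integrable (fun x => max (frmC n a x) 0) (Measure.dirac y) := fun y =>
      intg_of_cont (mkPM (Measure.dirac y) inferInstance) hcont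
    have hval : ∫ x, max (frmC n a x) 0 ∂(c • ν) = c.toReal * ∑ j : Fin (n + 1), |frm n a (gth n j)| := by
      rw [integral_smul_measure, integral_finset_sum_measure fun j _ => (hi _).add_measure (hi _), smul_eq_mul]
      congr 1
      refine Finset.sum_congr rfl fun j _ => ?_
      rw [integral_add_measure (hi _) (hi _), integral_dirac, integral_dirac, frmC_coe, frmC_coe, frm_anti hn]
      rcases le_total (frm n a (gth n j)) 0 with h | h
      · rw [max_eq_right h, max_eq_left (by linarith), abs_of_nonpos h, zero_add]
      · rw [max_eq_left h, max_eq_right (by linarith), abs_of_nonneg h, add_zero]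
    have hcpos : 0 < c.toReal := ENNReal.toReal_pos (ENNReal.inv_ne_zero.2 hct) (ENNReal.inv_ne_top.2 hc0)
    have hsum : 0 < ∑ j : Fin (n + 1), |frm n a (gth n j)| := by
      by_contra hle
      have h0 : ∑ j : Fin (n + 1), |frm n a (gth n j)| = 0 :=
        le_antisymm (not_lt.1 hle) (Finset.sum_nonneg fun _ _ => abs_nonneg _)
      rw [Finset.sum_eq_zero_iff_of_nonneg fun _ _ => abs_nonneg _] at h0
      refine ha (frm_eq_zero n a (gth n) ?_ fun i => abs_eq_zero.1 (h0 i (Finset.mem_univ _)))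
      intro i j hij
      have hN : (0 : ℝ) < n + 1 := by positivity
      have hd : gth n j - gth n i = Real.pi * ((j.1 - i.1 : ℝ) / (n + 1)) := by unfold gth; ring
      have hij' : (i.1 : ℝ) < j.1 := by exact_mod_cast hij
      have hj : (j.1 : ℝ) < n + 1 := by exact_mod_cast j.2
      have hi0 : (0 : ℝ) ≤ i.1 := by positivity
      have hq0 : 0 < (j.1 - i.1 : ℝ) / (n + 1) := div_pos (by linarith) hN
      have hq1 : (j.1 - i.1 : ℝ) / (n + 1) < 1 := by rw [div_lt_one hN]; linarith
      refine (Real.sin_pos_of_pos_of_lt_pi ?_ ?_).ne' <;> rw [hd]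
      · exact mul_pos Real.pi_pos hq0
      · nlinarith [Real.pi_pos]
    have : 0 < ∫ x, max (frmC n a x) 0 ∂(c • ν) := by rw [hval]; positivity
    unfold eps
    rw [mkPM_toMeasure]
    linarith

/-- Homotopy of maps into the thickening. -/
def HP {X : Type*} [TopologicalSpace X] (r : ℝ) (F G : X → PM) : Prop :=
  ∃ (hF : Continuous F) (hF' : ∀ x, F x ∈ VRm Circ r) (hG : Continuous G) (hG' : ∀ x, G x ∈ VRm Circ r),
    ContinuousMap.Homotopic (⟨fun x => ⟨F x, hF' x⟩, hF.subtype_mk _⟩ : C(X, ↥(VRm Circ r)))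
      ⟨fun x => ⟨G x, hG' x⟩, hG.subtype_mk _⟩

lemma HP.trans {X : Type*} [TopologicalSpace X] {r : ℝ} {F G H : X → PM} (h : HP r F G) (h' : HP r G H) :
    HP r F H := by
  obtain ⟨hF, hF', hG, hG', hh⟩ := h
  obtain ⟨_, _, hH, hH', hh'⟩ := h'
  exact ⟨hF, hF', hH, hH', hh.trans hh'⟩

lemma HP.of {X : Type*} [TopologicalSpace X] {r : ℝ} {F G : X → PM} (K : unitInterval × X → PM)
    (hc : Continuous K) (hm : ∀ q, K q ∈ VRm Circ r) (h0 : ∀ x, K (0, x) = F x) (h1 : ∀ x, K (1, x) = G x) :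
    HP r F G := by
  have eF : F = fun x => K (0, x) := (funext h0).symm
  have eG : G = fun x => K (1, x) := (funext h1).symm
  subst eF eG
  exact ⟨by fun_prop, fun x => hm _, by fun_prop, fun x => hm _,
    ⟨⟨⟨fun q => ⟨K q, hm q⟩, hc.subtype_mk _⟩, fun x => rfl, fun x => rfl⟩⟩⟩

lemma sph_homotopic {X E : Type*} [TopologicalSpace X] [NormedAddCommGroup E] [NormedSpace ℝ E]
    (u w : C(X, ↥(sphere (0 : E) 1))) (H : unitInterval × X → E) (hc : Continuous H) (hne : ∀ q, H q ≠ 0)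
    (h0 : ∀ x, ∃ c : ℝ, 0 < c ∧ H (0, x) = c • (u x : E)) (h1 : ∀ x, ∃ c : ℝ, 0 < c ∧ H (1, x) = c • (w x : E)) :
    u.Homotopic w := by
  have key : ∀ (v : ↥(sphere (0 : E) 1)) (y : E), (∃ c : ℝ, 0 < c ∧ y = c • (v : E)) → ‖y‖⁻¹ • y = v := by
    rintro v y ⟨c, hc, rfl⟩
    have hv : ‖(v : E)‖ = 1 := by simpa using v.2
    rw [norm_smul, hv, mul_one, Real.norm_of_nonneg hc.le, smul_smul, inv_mul_cancel₀ hc.ne', one_smul]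
  refine ⟨⟨⟨fun q => ⟨‖H q‖⁻¹ • H q, ?_⟩, ?_⟩, fun x => Subtype.ext (key _ _ (h0 x)), fun x => Subtype.ext (key _ _ (h1 x))⟩⟩
  · rw [mem_sphere_zero_iff_norm, norm_smul, norm_inv, norm_norm, inv_mul_cancel₀ (norm_ne_zero_iff.2 (hne q))]
  · exact ((hc.norm.inv₀ fun q => norm_ne_zero_iff.2 (hne q)).smul hc).subtype_mk _

lemma mem_TC_VRm {n : ℕ} {a : EuclideanSpace ℝ (Fin (n + 1))} {ε t r : ℝ} (h : Adm n a ε) (ht : t ∈ Icc (0 : ℝ) 1)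
    (hr : Real.pi - r ≤ Real.pi / n) {μ : PM} {A : Set Circ} (hA : A.Finite) (hμ : Car μ A)
    (hp : ∀ x ∈ A, ε ≤ frmC n a x) (hd : t = 1 ∨ ∀ x ∈ A, ∀ y ∈ A, dist x y ≤ r) (hT : Continuous (TC n a ε t)) :
    push (TC n a ε t) μ ∈ VRm Circ r := by
  refine VRm_of_car (hA.image _) (push_car hT hA hμ) ?_
  rintro _ ⟨x, hx, rfl⟩ _ ⟨y, hy, rfl⟩
  exact h.TC_dist ht hr (hp x hx) (hp y hy) (hd.imp id fun h => h x hx y hy)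

lemma TC_cont1 {n : ℕ} {a : EuclideanSpace ℝ (Fin (n + 1))} {ε : ℝ} (h : Adm n a ε) (t : ℝ) :
    Continuous (TC n a ε t) :=
  (TC_cont (Z := Unit) (a := fun _ => a) (ε := fun _ => ε) (t := fun _ => t) continuous_const continuous_const
    continuous_const fun _ => h).comp (Continuous.prodMk_right ())

theorem main_equiv (n : ℕ) (hn : Odd n) (r : ℝ) (hr1 : Real.pi - r ≤ Real.pi / n)
    (hr2 : Real.pi / (n + 2) < Real.pi - r) :
    Nonempty (ContinuousMap.HomotopyEquiv (↥(VRm Circ r))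
      (↥(Metric.sphere (0 : EuclideanSpace ℝ (Fin (n + 1))) 1))) := by
  obtain ⟨β, B, hB, hβ, hβpos⟩ := exists_grid n hn
  have hSne : ∀ p : ↥(Metric.sphere (0 : EuclideanSpace ℝ (Fin (n + 1))) 1), (p : EuclideanSpace ℝ (Fin (n + 1))) ≠ 0 :=
    fun p => ne_zero_of_mem_unit_sphere p
  have hmne : ∀ μ : ↥(VRm Circ r), mom n μ.1 ≠ 0 := by
    intro μ
    obtain ⟨hf, hc, hd⟩ := car_of_VRm μ.2
    obtain ⟨a, ha⟩ := exists_pos_form_of_diam hn hf hc.nonempty hd hr2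
    exact mom_ne hc ha
  -- the map to the sphere
  let f : C(↥(VRm Circ r), ↥(Metric.sphere (0 : EuclideanSpace ℝ (Fin (n + 1))) 1)) :=
    ⟨fun μ => ⟨‖mom n μ.1‖⁻¹ • mom n μ.1, by
      rw [mem_sphere_zero_iff_norm, norm_smul, norm_inv, norm_norm, inv_mul_cancel₀ (norm_ne_zero_iff.2 (hmne μ))]⟩, by
      have hc := mom_cont n (continuous_subtype_val (p := fun μ => μ ∈ VRm Circ r))
      exact ((hc.norm.inv₀ fun q => norm_ne_zero_iff.2 (hmne q)).smul hc).subtype_mk _⟩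
  have hfval : ∀ μ, (f μ : EuclideanSpace ℝ (Fin (n + 1))) = ‖mom n μ.1‖⁻¹ • mom n μ.1 := fun μ => rfl
  -- the map from the sphere
  have hadm0 : ∀ p : ↥(Metric.sphere (0 : EuclideanSpace ℝ (Fin (n + 1))) 1), Adm n p.1 (eps n p.1 β) := fun p =>
    eps_adm hn (hSne p) (hβpos _ (hSne p)) le_rfl
  have hRcar : ∀ p : ↥(Metric.sphere (0 : EuclideanSpace ℝ (Fin (n + 1))) 1),
      Car (Rw n p.1 β) {x ∈ B | eps n p.1 β ≤ frmC n p.1 x} := fun p => Rw_car (hβpos _ (hSne p)) hB hβ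
  have hBfin : ∀ P : Circ → Prop, {x ∈ B | P x}.Finite := fun P => hB.subset (sep_subset _ _)
  have hRc : Continuous fun p : ↥(Metric.sphere (0 : EuclideanSpace ℝ (Fin (n + 1))) 1) => Rw n p.1 β :=
    Rw_cont continuous_subtype_val continuous_const fun p => hβpos _ (hSne p)
  have hec : Continuous fun p : ↥(Metric.sphere (0 : EuclideanSpace ℝ (Fin (n + 1))) 1) => eps n p.1 β :=
    eps_cont continuous_subtype_val continuous_const
  have hone : (1 : ℝ) ∈ Icc (0 : ℝ) 1 := by simp
  let g : C(↥(Metric.sphere (0 : EuclideanSpace ℝ (Fin (n + 1))) 1), ↥(VRm Circ r)) :=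
    ⟨fun p => ⟨push (TC n p.1 (eps n p.1 β) 1) (Rw n p.1 β),
      mem_TC_VRm (hadm0 p) hone hr1 (hBfin _) (hRcar p) (fun x hx => hx.2) (Or.inl rfl) (TC_cont1 (hadm0 p) 1)⟩,
      (push_cont hRc (TC_cont continuous_subtype_val hec continuous_const hadm0)).subtype_mk _⟩
  have hgval : ∀ p, (g p : PM) = push (TC n p.1 (eps n p.1 β) 1) (Rw n p.1 β) := fun p => rfl
  refine ⟨⟨f, g, ?_, ?_⟩⟩
  · -- the composite on the thickening
    have hfn : ∀ μ, (f μ).1 ≠ 0 := fun μ => hSne _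
    have hfc : Continuous fun μ => (f μ).1 := continuous_subtype_val.comp f.continuous
    have hμc : Continuous fun μ : ↥(VRm Circ r) => μ.1 := continuous_subtype_val
    have he1 : ∀ μ : ↥(VRm Circ r), 0 < eps n (f μ).1 μ.1 := fun μ => eps_pos_of_mom (hmne μ)
    have he0 : ∀ μ : ↥(VRm Circ r), 0 < eps n (f μ).1 β := fun μ => hβpos _ (hfn μ)
    let e : ↥(VRm Circ r) → ℝ := fun μ => min (eps n (f μ).1 μ.1) (eps n (f μ).1 β)
    have hecont : Continuous e := (eps_cont hfc hμc).min (eps_cont hfc continuous_const)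
    have hepos : ∀ μ, 0 < e μ := fun μ => lt_min (he1 μ) (he0 μ)
    have hea : ∀ μ, Adm n (f μ).1 (e μ) := fun μ => eps_adm hn (hfn μ) (hepos μ) (min_le_left _ _)
    have hhc : Continuous fun μ : ↥(VRm Circ r) => Rw n (f μ).1 μ.1 := Rw_cont hfc hμc he1
    have hgc : Continuous fun μ : ↥(VRm Circ r) => Rw n (f μ).1 β := Rw_cont hfc continuous_const he0
    have hhcar : ∀ μ : ↥(VRm Circ r), Car (Rw n (f μ).1 μ.1) {x ∈ mSupport μ.1 | eps n (f μ).1 μ.1 ≤ frmC n (f μ).1 x} :=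
      fun μ => Rw_car (he1 μ) (car_of_VRm μ.2).1 (car_of_VRm μ.2).2.1
    have hcf : Continuous fun q : unitInterval × ↥(VRm Circ r) => (f q.2).1 := hfc.comp continuous_snd
    have hce : Continuous fun q : unitInterval × ↥(VRm Circ r) => e q.2 := hecont.comp continuous_snd
    have hct : Continuous fun q : unitInterval × ↥(VRm Circ r) => (q.1 : ℝ) := continuous_subtype_val.comp continuous_fst
    have H1 : HP r (fun μ : ↥(VRm Circ r) => μ.1) (fun μ => Rw n (f μ).1 μ.1) := by
      refine HP.of (fun q => mix q.1 q.2.1 (Rw n (f q.2).1 q.2.1)) ?_ ?_ ?_ ?_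
      · exact mix_cont (hμc.comp continuous_snd) (hhc.comp continuous_snd) hct fun q => q.1.2
      · intro q
        obtain ⟨hf, hc, hd⟩ := car_of_VRm q.2.2
        exact VRm_of_car hf (mix_car q.1.2 hc ((hhcar q.2).mono (sep_subset _ _))) hd
      · intro μ; exact mix_zero _ _
      · intro μ; exact mix_one _ _
    have H2 : HP r (fun μ : ↥(VRm Circ r) => Rw n (f μ).1 μ.1)
        (fun μ => push (TC n (f μ).1 (e μ) 1) (Rw n (f μ).1 μ.1)) := by
      refine HP.of (fun q => push (TC n (f q.2).1 (e q.2) q.1) (Rw n (f q.2).1 q.2.1)) ?_ ?_ ?_ ?_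
      · exact push_cont (hhc.comp continuous_snd) (TC_cont hcf hce hct fun q => hea q.2)
      · intro q
        obtain ⟨hf, hc, hd⟩ := car_of_VRm q.2.2
        exact mem_TC_VRm (hea q.2) q.1.2 hr1 (hf.subset (sep_subset _ _)) (hhcar q.2)
          (fun x hx => (min_le_left _ _).trans hx.2) (Or.inr fun x hx y hy => hd x hx.1 y hy.1) (TC_cont1 (hea q.2) _)
      · intro μ; exact push_id (fun x => TC_zero x) _
      · intro μ; rfl
    have H3 : HP r (fun μ : ↥(VRm Circ r) => push (TC n (f μ).1 (e μ) 1) (Rw n (f μ).1 μ.1))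
        (fun μ => push (TC n (f μ).1 (e μ) 1) (Rw n (f μ).1 β)) := by
      refine HP.of (fun q => push (TC n (f q.2).1 (e q.2) 1) (mix q.1 (Rw n (f q.2).1 q.2.1) (Rw n (f q.2).1 β))) ?_ ?_ ?_ ?_
      · exact push_cont (mix_cont (hhc.comp continuous_snd) (hgc.comp continuous_snd) hct fun q => q.1.2)
          (TC_cont hcf hce continuous_const fun q => hea q.2)
      · intro q
        obtain ⟨hf, hc, hd⟩ := car_of_VRm q.2.2
        refine mem_TC_VRm (hea q.2) hone hr1 ((hf.subset (sep_subset _ _)).union (hBfin _))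
          (mix_car q.1.2 ((hhcar q.2).mono subset_union_left) ((hRcar (f q.2)).mono subset_union_right))
          ?_ (Or.inl rfl) (TC_cont1 (hea q.2) _)
        rintro x (hx | hx)
        · exact (min_le_left _ _).trans hx.2
        · exact (min_le_right _ _).trans hx.2
      · intro μ; simp [mix_zero]
      · intro μ; simp [mix_one]
    have H4 : HP r (fun μ : ↥(VRm Circ r) => push (TC n (f μ).1 (e μ) 1) (Rw n (f μ).1 β))
        (fun μ => push (TC n (f μ).1 (eps n (f μ).1 β) 1) (Rw n (f μ).1 β)) := by
      let d : unitInterval × ↥(VRm Circ r) → ℝ := fun q => (1 - q.1) * e q.2 + q.1 * eps n (f q.2).1 β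
      have hle : ∀ q, e q.2 ≤ d q ∧ d q ≤ eps n (f q.2).1 β := by
        intro q
        have h1 : e q.2 ≤ eps n (f q.2).1 β := min_le_right _ _
        have h2 := q.1.2.1
        have h3 := q.1.2.2
        simp only [d]
        constructor <;> nlinarith
      have hda : ∀ q, Adm n (f q.2).1 (d q) := fun q =>
        eps_adm hn (hfn q.2) ((hepos q.2).trans_le (hle q).1) (hle q).2
      have hdc : Continuous d :=
        ((continuous_const.sub hct).mul hce).add (hct.mul ((eps_cont hfc continuous_const).comp continuous_snd))
      refine HP.of (fun q => push (TC n (f q.2).1 (d q) 1) (Rw n (f q.2).1 β)) ?_ ?_ ?_ ?_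
      · exact push_cont (hgc.comp continuous_snd) (TC_cont hcf hdc continuous_const hda)
      · intro q
        exact mem_TC_VRm (hda q) hone hr1 (hBfin _) (hRcar (f q.2)) (fun x hx => (hle q).2.trans hx.2) (Or.inl rfl)
          (TC_cont1 (hda q) _)
      · intro μ; simp [d]
      · intro μ; simp [d]
    obtain ⟨_, _, _, _, hH⟩ := ((H1.trans H2).trans H3).trans H4
    exact hH.symm
  · -- the composite on the sphere
    have hRpos : ∀ p : ↥(Metric.sphere (0 : EuclideanSpace ℝ (Fin (n + 1))) 1), 0 < inner ℝ p.1 (mom n (Rw n p.1 β)) := by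
      intro p
      rw [mom_inner]
      exact (hRcar p).integral_pos (frmC_cont' n _) fun x hx => (hadm0 p).pos.trans_le hx.2
    have hRne : ∀ p : ↥(Metric.sphere (0 : EuclideanSpace ℝ (Fin (n + 1))) 1), mom n (Rw n p.1 β) ≠ 0 := by
      intro p h0
      have := hRpos p
      rw [h0, inner_zero_right] at this
      exact lt_irrefl _ this
    have hmc := mom_cont n hRc
    let q : C(↥(Metric.sphere (0 : EuclideanSpace ℝ (Fin (n + 1))) 1), ↥(Metric.sphere (0 : EuclideanSpace ℝ (Fin (n + 1))) 1)) :=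
      ⟨fun p => ⟨‖mom n (Rw n p.1 β)‖⁻¹ • mom n (Rw n p.1 β), by
        rw [mem_sphere_zero_iff_norm, norm_smul, norm_inv, norm_norm, inv_mul_cancel₀ (norm_ne_zero_iff.2 (hRne p))]⟩,
        by exact ((hmc.norm.inv₀ fun q => norm_ne_zero_iff.2 (hRne q)).smul hmc).subtype_mk _⟩
    have hsc : ∀ v : EuclideanSpace ℝ (Fin (n + 1)), v ≠ 0 → ∃ c : ℝ, 0 < c ∧ v = c • (‖v‖⁻¹ • v) := fun v hv =>
      ⟨‖v‖, norm_pos_iff.2 hv, by rw [smul_smul, mul_inv_cancel₀ (norm_ne_zero_iff.2 hv), one_smul]⟩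
    have G1 : (f.comp g).Homotopic q := by
      refine sph_homotopic _ _ (fun z => mom n (push (TC n z.2.1 (eps n z.2.1 β) (1 - z.1)) (Rw n z.2.1 β))) ?_ ?_ ?_ ?_
      · refine mom_cont n (push_cont (hRc.comp continuous_snd) (TC_cont (continuous_subtype_val.comp continuous_snd)
          (hec.comp continuous_snd) (continuous_const.sub (continuous_subtype_val.comp continuous_fst)) fun z => hadm0 z.2))
      · intro z
        have ht : 1 - (z.1 : ℝ) ∈ Icc (0 : ℝ) 1 := ⟨by linarith [z.1.2.2], by linarith [z.1.2.1]⟩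
        obtain ⟨b, hb⟩ := exists_pos_form_TC (hadm0 z.2) ht (hBfin _) (hRcar z.2).nonempty fun x hx => hx.2
        refine mom_ne (push_car (TC_cont1 (hadm0 z.2) _) (hBfin _) (hRcar z.2)) (a := b) ?_
        rintro _ ⟨x, hx, rfl⟩
        exact hb x hx
      · intro p
        have := hsc _ (hmne (g p))
        simpa [hgval, hfval] using this
      · intro p
        have e1 : push (TC n p.1 (eps n p.1 β) (1 - ((1 : unitInterval) : ℝ))) (Rw n p.1 β) = Rw n p.1 β :=
          push_id (fun x => by simp [TC_zero]) _
        simp only [e1]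
        exact hsc _ (hRne p)
    have G2 : q.Homotopic (ContinuousMap.id _) := by
      refine sph_homotopic _ _ (fun z => (1 - (z.1 : ℝ)) • mom n (Rw n z.2.1 β) + (z.1 : ℝ) • z.2.1) ?_ ?_ ?_ ?_
      · have := hmc.comp (continuous_snd (X := unitInterval))
        have h2 : Continuous fun z : unitInterval × ↥(Metric.sphere (0 : EuclideanSpace ℝ (Fin (n + 1))) 1) => (z.1 : ℝ) :=
          continuous_subtype_val.comp continuous_fst
        exact ((continuous_const.sub h2).smul this).add (h2.smul (continuous_subtype_val.comp continuous_snd))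
      · intro z h0
        have h1 : inner ℝ z.2.1 ((1 - (z.1 : ℝ)) • mom n (Rw n z.2.1 β) + (z.1 : ℝ) • z.2.1) = 0 := by
          rw [h0, inner_zero_right]
        have hv : ‖z.2.1‖ = 1 := by simp
        rw [inner_add_right, real_inner_smul_right, real_inner_smul_right, real_inner_self_eq_norm_sq, hv] at h1
        have h2 := hRpos z.2
        have h3 := z.1.2.1
        have h4 := z.1.2.2
        rcases h3.eq_or_lt with h | h
        · rw [← h] at h1; linarith
        · nlinarith [mul_nonneg (sub_nonneg.2 h4) h2.le]
      · intro p
        have := hsc _ (hRne p)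
        simpa [q] using this
      · intro p
        exact ⟨1, one_pos, by simp⟩
    exact G1.trans G2

/-- For `2πk/(2k+1) ≤ r < 2π(k+1)/(2k+3)`, the Vietoris--Rips metric thickening
`VR^m(S¹; r)` is homotopy equivalent to the `(2k+1)`-sphere. -/
theorem vrm_circle_homotopyEquiv_sphere (k : ℕ) (r : ℝ)
    (h1 : 2 * Real.pi * k / (2 * k + 1) ≤ r)
    (h2 : r < 2 * Real.pi * (k + 1) / (2 * k + 3)) :
    Nonempty (ContinuousMap.HomotopyEquiv (↥(VRm Circ r))
      (↥(Metric.sphere (0 : EuclideanSpace ℝ (Fin (2 * k + 2))) 1))) := by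
  refine main_equiv (2 * k + 1) ⟨k, rfl⟩ r ?_ ?_
  · have e : Real.pi - 2 * Real.pi * k / (2 * k + 1) = Real.pi / (2 * k + 1) := by
      field_simp; ring
    push_cast
    linarith
  · have e : Real.pi - 2 * Real.pi * (k + 1) / (2 * k + 3) = Real.pi / (2 * k + 3) := by
      field_simp; ring
    push_cast
    have e2 : (2 * (k : ℝ) + 1 + 2) = 2 * k + 3 := by ring
    rw [e2]
    linarith
end
end

section
/- For every r with 0 ≤ r < 2π/3, the rotation action of the circle group S^1 = ℝ/2πℤ on VR^m(S^1;r) is free: if θ·μ = μ for some μ ∈ VR^m(S^1;r) and θ ∈ ℝ/2πℤ, then θ = 0. -/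
open MeasureTheory Metric Set
open scoped NNReal ENNReal

noncomputable section

/-- The rotation action of the circle group `ℝ/2πℤ` on probability measures on the circle:
`θ · Σ_j a_j δ_{θ_j} = Σ_j a_j δ_{θ+θ_j}`. -/
def rot (θ : Circ) (μ : ProbabilityMeasure Circ) : ProbabilityMeasure Circ :=
  μ.map (f := fun x => θ + x) (continuous_add_left θ).measurable.aemeasurable

/-- If all multiples of a real `t` have small norm on the circle, then `t` is zero there. -/
theorem circ_eq_zero_of_small (θ : Circ) (hs : ∀ n : ℕ, ‖n • θ‖ < 2 * Real.pi / 3) : θ = 0 := by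
  by_contra hne
  have hpi := Real.pi_pos
  obtain ⟨t, rfl⟩ := QuotientAddGroup.mk_surjective θ
  change ∀ n : ℕ, ‖n • (t : Circ)‖ < 2 * Real.pi / 3 at hs
  change ¬ ((t : Circ) = 0) at hne
  -- reduce to a small representative
  obtain ⟨u, hu, hut⟩ : ∃ u : ℝ, (u : Circ) = (t : Circ) ∧ ‖(t : Circ)‖ = |u| := by
    refine ⟨t - round ((2 * Real.pi)⁻¹ * t) * (2 * Real.pi), ?_, AddCircle.norm_eq _⟩
    rw [← zsmul_eq_mul]
    rw [AddCircle.coe_sub, AddCircle.coe_zsmul, AddCircle.coe_period]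
    simp
  rw [← hu] at hs hne hut
  have hupos : 0 < |u| := by
    rw [← hut]; exact norm_pos_iff.mpr hne
  have hult : |u| < 2 * Real.pi / 3 := by
    have := hs 1
    rw [one_smul, hut] at this
    exact this
  have hex : ∃ n : ℕ, 2 * Real.pi / 3 ≤ n * |u| := by
    obtain ⟨n, hn⟩ := Archimedean.arch (2 * Real.pi / 3) hupos
    exact ⟨n, by simpa [nsmul_eq_mul] using hn⟩
  classical
  obtain ⟨n, hn, hmin⟩ : ∃ n : ℕ, 2 * Real.pi / 3 ≤ n * |u| ∧
      ∀ m < n, ¬ (2 * Real.pi / 3 ≤ m * |u|) :=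
    ⟨Nat.find hex, Nat.find_spec hex, fun m hm => Nat.find_min hex hm⟩
  have hn4 : n * |u| < 4 * Real.pi / 3 := by
    rcases n with _ | k
    · simp; positivity
    · have := hmin k (Nat.lt_succ_self k)
      push_cast
      linarith
  have h1 := hs n
  rw [← AddCircle.coe_nsmul, AddCircle.norm_eq, nsmul_eq_mul] at h1
  generalize round ((2 * Real.pi)⁻¹ * (n * u)) = m at h1
  have habs : |(n : ℝ) * u| = n * |u| := by rw [abs_mul, Nat.abs_cast]
  rw [← habs] at hn hn4
  have h2 := abs_sub_abs_le_abs_sub ((n : ℝ) * u) (m * (2 * Real.pi))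
  have h3 := abs_sub_abs_le_abs_sub (m * (2 * Real.pi)) ((n : ℝ) * u)
  rw [abs_sub_comm] at h3
  by_cases hm : m = 0
  · subst hm
    rw [Int.cast_zero, zero_mul, sub_zero] at h1
    linarith
  · have h4 : (1 : ℝ) ≤ |(m : ℝ)| := by exact_mod_cast Int.one_le_abs hm
    have h5 : |(m : ℝ) * (2 * Real.pi)| = |(m : ℝ)| * (2 * Real.pi) := by
      rw [abs_mul, abs_of_pos (by positivity : 0 < 2 * Real.pi)]
    have h6 : 2 * Real.pi ≤ |(m : ℝ)| * (2 * Real.pi) := by nlinarith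
    linarith

/-- For `0 ≤ r < 2π/3`, the rotation action of the circle group `ℝ/2πℤ` on `VR^m(S¹; r)`
is free. -/
theorem rot_free_on_vrm (r : ℝ) (h0 : 0 ≤ r) (h : r < 2 * Real.pi / 3)
    (μ : ProbabilityMeasure Circ) (hμ : μ ∈ VRm Circ r) (θ : Circ) (hfix : rot θ μ = μ) :
    θ = 0 := by
  obtain ⟨⟨S, hS⟩, hd⟩ := hμ
  have hinv : ∀ x, x ∈ mSupport μ → θ + x ∈ mSupport μ := by
    intro x hx
    have h1 : (rot θ μ).toMeasure {θ + x} = μ.toMeasure {x} := by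
      unfold rot
      rw [ProbabilityMeasure.toMeasure_map,
        Measure.map_apply (continuous_add_left θ).measurable (measurableSet_singleton _)]
      congr 1
      ext y
      simp
    rw [hfix] at h1
    change μ.toMeasure {θ + x} ≠ 0
    rw [h1]
    exact hx
  obtain ⟨x, hx⟩ : ∃ x, x ∈ mSupport μ := by
    by_contra hno
    push Not at hno
    have : μ.toMeasure (S : Set Circ) = 0 := by
      refine (measure_null_iff_singleton S.countable_toSet).mpr fun y _ => ?_
      exact not_not.mp (hno y)
    rw [hS] at this
    exact one_ne_zero this
  have hall : ∀ n : ℕ, n • θ + x ∈ mSupport μ := by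
    intro n
    induction n with
    | zero => simpa using hx
    | succ k ih =>
      have := hinv _ ih
      rwa [← add_assoc, ← succ_nsmul'] at this
  refine circ_eq_zero_of_small θ fun n => ?_
  have hb : Bornology.IsBounded (mSupport μ) :=
    isCompact_univ.isBounded.subset (subset_univ _)
  have := dist_le_diam_of_mem hb (hall n) hx
  rw [dist_eq_norm, add_sub_cancel_right] at this
  linarith
end
end
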